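/- arXiv:2304.14172 — 5 statements merged into one kernel-verified Lean document; each statement's English description precedes it below -/
import Mathlib

section
/- Let G be a finite graph, W ⊆ V(G), and g, f : V(G) → ℤ two functions satisfying g(v) ≤ f(v) for all v ∈ V(G) and g(v) ≡ f(v) (mod 2) for all v ∈ W. Then G has a partial parity (g,f)-factor with respect to W if and only if for all disjoint subsets A and B of V(G), δ_G(A,B) := Σ_{v∈A} f(v) − Σ_{v∈B} g(v) + Σ_{v∈B} d_{G−A}(v) − h_W(A,B) ≥ 0, where h_W(A,B) is the number of components D of G − (A ∪ B) such that g(v) = f(v) for all v ∈ V(D) \ W and Σ_{v∈V(D)} f(v) + e_G(D,B) ≡ 1 (mod 2). -/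
noncomputable section

/-- `eCnt G S T` is the number of edges of `G` with one endpoint in `S` and the other in `T`
(intended for disjoint `S` and `T`). -/
def eCnt {V : Type*} (G : SimpleGraph V) (S T : Set V) : ℕ :=
  Nat.card {p : V × V // p.1 ∈ S ∧ p.2 ∈ T ∧ G.Adj p.1 p.2}

/-- The degree of `v` in `G − A` (the induced subgraph on the complement of `A`). -/
def degDel {V : Type*} (G : SimpleGraph V) (A : Set V) (v : V) : ℕ :=
  (G.neighborSet v \ A).ncard

/-- The vertex set of a connected component of an induced subgraph, viewed inside the
ambient vertex set. -/
def compSupp {V : Type*} {G : SimpleGraph V} {s : Set V}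
    (c : (G.induce s).ConnectedComponent) : Set V :=
  Subtype.val '' c.supp

/-- A component `D` of `G − (A ∪ B)` is odd if `Σ_{v ∈ V(D)} f v + e_G(D,B)` is odd. -/
def IsOddComp {V : Type*} (G : SimpleGraph V) (f : V → ℤ) (A B : Set V)
    (c : (G.induce (A ∪ B)ᶜ).ConnectedComponent) : Prop :=
  Odd ((∑ᶠ v ∈ compSupp c, f v) + (eCnt G (compSupp c) B : ℤ))

/-- A component `D` of `G − (A ∪ B)` is even if `Σ_{v ∈ V(D)} f v + e_G(D,B)` is even. -/
def IsEvenComp {V : Type*} (G : SimpleGraph V) (f : V → ℤ) (A B : Set V)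
    (c : (G.induce (A ∪ B)ᶜ).ConnectedComponent) : Prop :=
  Even ((∑ᶠ v ∈ compSupp c, f v) + (eCnt G (compSupp c) B : ℤ))

/-- `h_W(A,B)`: the number of components `D` of `G − (A ∪ B)` such that `g v = f v` for all
`v ∈ V(D) \ W` and `Σ_{v ∈ V(D)} f v + e_G(D,B) ≡ 1 (mod 2)`. -/
def hWnum {V : Type*} (G : SimpleGraph V) (W : Set V) (g f : V → ℤ) (A B : Set V) : ℕ :=
  Nat.card {c : (G.induce (A ∪ B)ᶜ).ConnectedComponent //
    (∀ v ∈ compSupp c \ W, g v = f v) ∧ IsOddComp G f A B c}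

/-- `δ_G(A,B) = Σ_{v∈A} f v − Σ_{v∈B} g v + Σ_{v∈B} d_{G−A}(v) − h_W(A,B)`. -/
def deltaG {V : Type*} (G : SimpleGraph V) (W : Set V) (g f : V → ℤ) (A B : Set V) : ℤ :=
  (∑ᶠ v ∈ A, f v) - (∑ᶠ v ∈ B, g v) + (∑ᶠ v ∈ B, (degDel G A v : ℤ)) -
    (hWnum G W g f A B : ℤ)

/-- `F` is a partial parity `(g,f)`-factor of `G` with respect to `W`: a spanning subgraph with
`g v ≤ d_F v ≤ f v` for all `v` and `d_F v ≡ g v ≡ f v (mod 2)` for `v ∈ W`. -/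
def IsPPFactor {V : Type*} (G F : SimpleGraph V) (W : Set V) (g f : V → ℤ) : Prop :=
  F ≤ G ∧
  (∀ v : V, g v ≤ ((F.neighborSet v).ncard : ℤ) ∧ ((F.neighborSet v).ncard : ℤ) ≤ f v) ∧
  (∀ v ∈ W, Int.ModEq 2 ((F.neighborSet v).ncard : ℤ) (g v) ∧
    Int.ModEq 2 ((F.neighborSet v).ncard : ℤ) (f v))


namespace PartialParityFactor

open SimpleGraph

section Components

variable {N : Type*} {Γ : SimpleGraph N} {S : Set N}

/-- `K` avoids `S` and is closed under adjacency in `Γ − S`. -/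
def IsClosedOff (Γ : SimpleGraph N) (S K : Set N) : Prop :=
  K ⊆ Sᶜ ∧ ∀ x ∈ K, ∀ y ∉ S, Γ.Adj x y → y ∈ K

/-- `K` is the vertex set of a component of `Γ − S`, expressed as a minimal nonempty
closed set. -/
def IsCompSet (Γ : SimpleGraph N) (S K : Set N) : Prop :=
  K.Nonempty ∧ IsClosedOff Γ S K ∧ ∀ T ⊆ K, T.Nonempty → IsClosedOff Γ S T → T = K

/-- The family of vertex sets of the odd components of `Γ − S`. -/
def oddCompSets (Γ : SimpleGraph N) (S : Set N) : Set (Set N) :=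
  {K | IsCompSet Γ S K ∧ Odd K.ncard}

lemma IsClosedOff.inter {K L : Set N} (hK : IsClosedOff Γ S K) (hL : IsClosedOff Γ S L) :
    IsClosedOff Γ S (K ∩ L) :=
  ⟨fun _ hx => hK.1 hx.1, fun x hx y hy h => ⟨hK.2 x hx.1 y hy h, hL.2 x hx.2 y hy h⟩⟩

lemma IsCompSet.subset_of_isClosedOff {K L : Set N} (hK : IsCompSet Γ S K)
    (hL : IsClosedOff Γ S L) {x : N} (hxK : x ∈ K) (hxL : x ∈ L) : K ⊆ L := by
  have := hK.2.2 (K ∩ L) Set.inter_subset_left ⟨x, hxK, hxL⟩ (hK.2.1.inter hL)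
  exact Set.inter_eq_left.1 this

lemma IsCompSet.eq_of_mem {K L : Set N} (hK : IsCompSet Γ S K) (hL : IsCompSet Γ S L)
    {x : N} (hxK : x ∈ K) (hxL : x ∈ L) : K = L :=
  (hK.subset_of_isClosedOff hL.2.1 hxK hxL).antisymm
    (hL.subset_of_isClosedOff hK.2.1 hxL hxK)

lemma isCompSet_image_supp {U : Set N} (H : SimpleGraph U) (hH : ∀ a b, H.Adj a b ↔ Γ.Adj a b)
    (hU : U = Sᶜ) (c : H.ConnectedComponent) : IsCompSet Γ S (Subtype.val '' c.supp) := by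
  subst hU
  refine ⟨c.nonempty_supp.image _, ⟨?_, ?_⟩, ?_⟩
  · rintro _ ⟨x, -, rfl⟩
    exact x.2
  · rintro _ ⟨x, hx, rfl⟩ y hy hxy
    refine ⟨⟨y, hy⟩, ?_, rfl⟩
    exact c.mem_supp_of_adj_mem_supp hx ((hH _ _).2 hxy)
  · rintro T hT ⟨t, ht⟩ hcl
    refine hT.antisymm ?_
    rintro _ ⟨x, hx, rfl⟩
    obtain ⟨t', ht', rfl⟩ := hT ht
    have hr : H.Reachable t' x := ConnectedComponent.exact (ht'.trans hx.symm)
    obtain ⟨w⟩ := hr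
    clear hx ht'
    induction w with
    | nil => exact ht
    | @cons u v _ h w ih => exact ih (hcl.2 _ ht _ v.2 ((hH _ _).1 h))

lemma exists_image_supp_eq {U : Set N} (H : SimpleGraph U) (hH : ∀ a b, H.Adj a b ↔ Γ.Adj a b)
    (hU : U = Sᶜ) {K : Set N} (hK : IsCompSet Γ S K) :
    ∃ c : H.ConnectedComponent, Subtype.val '' c.supp = K := by
  obtain ⟨x, hx⟩ := hK.1
  have hxU : x ∈ U := hU ▸ hK.2.1.1 hx
  refine ⟨H.connectedComponentMk ⟨x, hxU⟩, ?_⟩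
  exact (isCompSet_image_supp H hH hU _).eq_of_mem hK ⟨⟨x, hxU⟩, rfl, rfl⟩ hx

lemma exists_isCompSet {x : N} (hx : x ∉ S) : ∃ K, IsCompSet Γ S K ∧ x ∈ K :=
  ⟨_, isCompSet_image_supp (Γ.induce Sᶜ) (fun _ _ => Iff.rfl) rfl
    ((Γ.induce Sᶜ).connectedComponentMk ⟨x, hx⟩), ⟨x, hx⟩, rfl, rfl⟩

lemma image_supp_injective {U : Set N} (H : SimpleGraph U) :
    Function.Injective (fun c : H.ConnectedComponent => Subtype.val '' c.supp) := fun _ _ h =>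
  ConnectedComponent.supp_injective (Set.image_injective.2 Subtype.val_injective h)

lemma oddCompSets_eq_image {U : Set N} (H : SimpleGraph U)
    (hH : ∀ a b, H.Adj a b ↔ Γ.Adj a b) (hU : U = Sᶜ) :
    oddCompSets Γ S = (fun c : H.ConnectedComponent => Subtype.val '' c.supp) ''
      H.oddComponents := by
  ext K
  constructor
  · rintro ⟨hK, hodd⟩
    obtain ⟨c, rfl⟩ := exists_image_supp_eq H hH hU hK
    rw [Set.ncard_image_of_injective _ Subtype.val_injective] at hodd
    exact ⟨c, hodd, rfl⟩
  · rintro ⟨c, hc, rfl⟩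
    refine ⟨isCompSet_image_supp H hH hU c, ?_⟩
    rw [Set.ncard_image_of_injective _ Subtype.val_injective]
    exact hc

lemma ncard_oddCompSets {U : Set N} (H : SimpleGraph U)
    (hH : ∀ a b, H.Adj a b ↔ Γ.Adj a b) (hU : U = Sᶜ) :
    (oddCompSets Γ S).ncard = H.oddComponents.ncard := by
  rw [oddCompSets_eq_image H hH hU, Set.ncard_image_of_injective _ (image_supp_injective H)]

lemma ncard_oddCompSets_parity [Finite N] (hN : Even (Nat.card N)) :
    Even ((oddCompSets Γ S).ncard + S.ncard) := by
  rw [ncard_oddCompSets (Γ.induce Sᶜ) (fun _ _ => Iff.rfl) rfl]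
  have h1 := odd_ncard_oddComponents (Γ.induce Sᶜ)
  have h2 := Set.ncard_add_ncard_compl S
  rw [Nat.card_coe_set_eq] at h1
  rw [Nat.even_add, ← Nat.not_odd_iff_even, h1, Nat.not_odd_iff_even, ← Nat.even_add, add_comm, h2]
  exact hN

/-- `x` and `y` are distinct, non-adjacent, and without a common neighbour in `Γ − S`. -/
def Far (Γ : SimpleGraph N) (S : Set N) (x y : N) : Prop :=
  x ≠ y ∧ ¬ Γ.Adj x y ∧ ∀ z ∉ S, Γ.Adj x z → ¬ Γ.Adj z y

/-- Every vertex of `S` has three neighbours outside `S` that are pairwise far apart. -/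
def IsTight (Γ : SimpleGraph N) (S : Set N) : Prop :=
  ∀ y ∈ S, ∃ x₁ x₂ x₃, x₁ ∉ S ∧ x₂ ∉ S ∧ x₃ ∉ S ∧ Γ.Adj y x₁ ∧ Γ.Adj y x₂ ∧ Γ.Adj y x₃ ∧
    Far Γ S x₁ x₂ ∧ Far Γ S x₁ x₃ ∧ Far Γ S x₂ x₃

lemma IsCompSet.far {K : Set N} (hK : IsCompSet Γ S K) {x y : N} (hx : x ∈ K) (hy : y ∉ S)
    (hyK : y ∉ K) : Far Γ S x y :=
  ⟨fun h => hyK (h ▸ hx), fun h => hyK (hK.2.1.2 x hx y hy h),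
    fun z hz hxz hzy => hyK (hK.2.1.2 z (hK.2.1.2 x hx z hz hxz) y hy hzy)⟩

/-- If `Γ` has no perfect matching, then a minimal Tutte barrier `S` has deficiency at least two,
and the neighbours of each of its vertices meet at least three components of `Γ − S`. -/
lemma exists_minimal_barrier [Finite N] (hN : Even (Nat.card N))
    (hΓ : ¬ ∃ M : Γ.Subgraph, M.IsPerfectMatching) :
    ∃ S : Set N, S.ncard + 2 ≤ (oddCompSets Γ S).ncard ∧ IsTight Γ S := by
  classical
  have hex : ∃ n, ∃ S : Set N, S.ncard = n ∧ S.ncard < (oddCompSets Γ S).ncard := by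
    rw [tutte] at hΓ
    push Not at hΓ
    obtain ⟨u, hu⟩ := hΓ
    refine ⟨_, u, rfl, ?_⟩
    rw [ncard_oddCompSets ((⊤ : Γ.Subgraph).deleteVerts u).coe _ (by ext; simp)]
    · exact hu
    · intro a b
      have ha := a.2
      have hb := b.2
      simp only [Subgraph.deleteVerts_verts, Subgraph.verts_top, Set.mem_sdiff, Set.mem_univ,
        true_and] at ha hb
      simp [ha, hb]
  obtain ⟨S, hSn, hS⟩ := Nat.find_spec hex
  have hmin : ∀ T : Set N, T.ncard < S.ncard → (oddCompSets Γ T).ncard ≤ T.ncard := by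
    intro T hT
    by_contra! h
    exact Nat.find_min hex (hSn ▸ hT) ⟨T, rfl, h⟩
  have hpar := ncard_oddCompSets_parity (Γ := Γ) (S := S) hN
  have hS2 : S.ncard + 2 ≤ (oddCompSets Γ S).ncard := by
    rcases hpar with ⟨r, hr⟩
    omega
  suffices key : ∀ y ∈ S, ∀ K L, IsCompSet Γ S K → IsCompSet Γ S L →
      ∃ x ∉ S, Γ.Adj y x ∧ x ∉ K ∧ x ∉ L by
    obtain ⟨J, hJ⟩ : (oddCompSets Γ S).Nonempty := Set.nonempty_of_ncard_ne_zero (by omega)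
    refine ⟨S, hS2, fun y hy => ?_⟩
    obtain ⟨x₁, hx₁, hyx₁, -, -⟩ := key y hy J J hJ.1 hJ.1
    obtain ⟨K₁, hK₁, hxK₁⟩ := exists_isCompSet (Γ := Γ) hx₁
    obtain ⟨x₂, hx₂, hyx₂, h₂₁, -⟩ := key y hy K₁ K₁ hK₁ hK₁
    obtain ⟨K₂, hK₂, hxK₂⟩ := exists_isCompSet (Γ := Γ) hx₂
    obtain ⟨x₃, hx₃, hyx₃, h₃₁, h₃₂⟩ := key y hy K₁ K₂ hK₁ hK₂
    exact ⟨x₁, x₂, x₃, hx₁, hx₂, hx₃, hyx₁, hyx₂, hyx₃, hK₁.far hxK₁ hx₂ h₂₁,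
      hK₁.far hxK₁ hx₃ h₃₁, hK₂.far hxK₂ hx₃ h₃₂⟩
  intro y hy K L hK hL
  by_contra! hcon
  have hlt : (S \ {y}).ncard + 1 = S.ncard := Set.ncard_sdiff_singleton_add_one hy
  have hle := hmin (S \ {y}) (by omega)
  have hsub : oddCompSets Γ S \ {K, L} ⊆ oddCompSets Γ (S \ {y}) := by
    rintro J ⟨⟨hJ, hodd⟩, hJKL⟩
    simp only [Set.mem_insert_iff, Set.mem_singleton_iff, not_or] at hJKL
    have hyJ : ∀ x ∈ J, ¬ Γ.Adj x y := by
      intro x hx hxy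
      by_cases hxK : x ∈ K
      · exact hJKL.1 (hJ.eq_of_mem hK hx hxK)
      · exact hJKL.2 (hJ.eq_of_mem hL hx (hcon x (hJ.2.1.1 hx) hxy.symm hxK))
    refine ⟨⟨hJ.1, ⟨fun x hx h => hJ.2.1.1 hx h.1, fun x hx z hz hxz => ?_⟩, ?_⟩, hodd⟩
    · refine hJ.2.1.2 x hx z (fun hzS => hz ⟨hzS, ?_⟩) hxz
      rintro rfl
      exact hyJ x hx hxz
    · intro T hT hTne hTcl
      refine hJ.2.2 T hT hTne ⟨hT.trans hJ.2.1.1, fun x hx z hz hxz => ?_⟩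
      exact hTcl.2 x hx z (fun h => hz h.1) hxz
  have h1 := Set.ncard_le_ncard hsub
  have h2 := Set.le_ncard_sdiff {K, L} (oddCompSets Γ S)
  have h3 : ({K, L} : Set (Set N)).ncard ≤ 2 := by
    simpa using Set.ncard_insert_le K {L}
  omega

end Components

section Counting

variable {V : Type*} [Fintype V]

lemma even_ncard_of_involution {α : Type*} [Finite α] (s : Set α) (σ : α → α)
    (hs : ∀ x ∈ s, σ x ∈ s) (hσ : ∀ x ∈ s, σ (σ x) = x) (hne : ∀ x ∈ s, σ x ≠ x) :
    Even s.ncard := by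
  classical
  have := Fintype.ofFinite α
  have h : ∑ x ∈ s.toFinset, (1 : ZMod 2) = 0 :=
    Finset.sum_involution (fun x _ => σ x) (fun _ _ => by decide)
      (fun x hx _ => hne x (by simpa using hx)) (fun x hx => by simpa using hs x (by simpa using hx))
      (fun x hx => hσ x (by simpa using hx))
  rw [Finset.sum_const, nsmul_eq_mul, mul_one, ZMod.natCast_eq_zero_iff_even] at h
  rwa [Set.ncard_eq_toFinset_card']

/-- The number of ordered pairs in `A × B` related by `R`. -/
def pairCount (R : V → V → Prop) (A B : Set V) : ℕ :=
  {p : V × V | p.1 ∈ A ∧ p.2 ∈ B ∧ R p.1 p.2}.ncard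

omit [Fintype V] in
lemma eCnt_eq_pairCount (G : SimpleGraph V) (A B : Set V) : eCnt G A B = pairCount G.Adj A B := rfl

open Classical in
lemma finsum_mem_eq_sum {M : Type*} [AddCommMonoid M] (A : Set V) (f : V → M) :
    ∑ᶠ v ∈ A, f v = ∑ v with v ∈ A, f v := by
  rw [finsum_mem_eq_toFinset_sum]
  congr 1
  ext; simp

open Classical in
lemma sum_ncard_eq_pairCount (R : V → V → Prop) (A B : Set V) :
    ∑ v with v ∈ A, {w | w ∈ B ∧ R v w}.ncard = pairCount R A B := by
  rw [pairCount, Set.ncard_eq_toFinset_card',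
    Finset.card_eq_sum_card_fiberwise (f := Prod.fst) (t := Finset.univ.filter (· ∈ A))]
  · refine Finset.sum_congr rfl fun v hv => ?_
    rw [Set.ncard_eq_toFinset_card']
    refine Finset.card_bij (fun w _ => (v, w)) ?_ ?_ ?_
    · intro w hw
      simp_all
    · simp
    · rintro ⟨x, y⟩ h
      simp_all
      grind
  · intro p hp
    simp_all

omit [Fintype V] in
lemma pairCount_comm {R : V → V → Prop} (hR : ∀ x y, R x y → R y x) (A B : Set V) :
    pairCount R A B = pairCount R B A := by
  refine Set.ncard_congr (fun p _ => p.swap) ?_ ?_ ?_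
  · rintro ⟨x, y⟩ ⟨h1, h2, h3⟩
    exact ⟨h2, h1, hR _ _ h3⟩
  · rintro a b - - h
    exact Prod.swap_injective h
  · rintro ⟨x, y⟩ ⟨h1, h2, h3⟩
    exact ⟨(y, x), ⟨h2, h1, hR _ _ h3⟩, rfl⟩

lemma pairCount_eq_add {R R₁ R₂ : V → V → Prop} {A B B₁ B₂ : Set V}
    (h : ∀ x ∈ A, ∀ y, (y ∈ B ∧ R x y) ↔ (y ∈ B₁ ∧ R₁ x y) ∨ (y ∈ B₂ ∧ R₂ x y))
    (hd : ∀ x ∈ A, ∀ y, y ∈ B₁ → R₁ x y → y ∈ B₂ → R₂ x y → False) :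
    pairCount R A B = pairCount R₁ A B₁ + pairCount R₂ A B₂ := by
  rw [pairCount, pairCount, pairCount, ← Set.ncard_union_eq]
  · congr 1
    ext ⟨x, y⟩
    have := h x
    simp only [Set.mem_ofPred_eq, Set.mem_union]
    grind
  · rw [Set.disjoint_left]
    rintro ⟨x, y⟩ ⟨h1, h2, h3⟩ ⟨h4, h5, h6⟩
    exact hd x h1 y h2 h3 h5 h6

lemma pairCount_mono {R R' : V → V → Prop} {A A' B B' : Set V}
    (h : ∀ x ∈ A, ∀ y ∈ B, R x y → x ∈ A' ∧ y ∈ B' ∧ R' x y) :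
    pairCount R A B ≤ pairCount R' A' B' :=
  Set.ncard_le_ncard fun p hp => h p.1 hp.1 p.2 hp.2.1 hp.2.2

lemma even_pairCount_self (F : SimpleGraph V) (D : Set V) : Even (pairCount F.Adj D D) :=
  even_ncard_of_involution _ Prod.swap (fun _ hp => ⟨hp.2.1, hp.1, hp.2.2.symm⟩)
    (fun _ _ => rfl) (fun _ hp h => hp.2.2.ne (congrArg Prod.snd h))

lemma finsum_degDel (G : SimpleGraph V) (A B : Set V) :
    ∑ᶠ v ∈ B, (degDel G A v : ℤ) = pairCount G.Adj B Aᶜ := by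
  classical
  rw [finsum_mem_eq_sum, ← sum_ncard_eq_pairCount, Nat.cast_sum]
  refine Finset.sum_congr rfl fun v _ => ?_
  refine congrArg (fun s : Set V => (s.ncard : ℤ)) ?_
  ext w
  simp [and_comm]

lemma finsum_degree (G : SimpleGraph V) (B : Set V) :
    ∑ᶠ v ∈ B, ((G.neighborSet v).ncard : ℤ) = pairCount G.Adj B Set.univ := by
  classical
  rw [finsum_mem_eq_sum, ← sum_ncard_eq_pairCount, Nat.cast_sum]
  refine Finset.sum_congr rfl fun v _ => ?_
  refine congrArg (fun s : Set V => (s.ncard : ℤ)) ?_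
  ext w
  simp

lemma finsum_mem_le_finsum_mem {A : Set V} {a b : V → ℤ} (h : ∀ v ∈ A, a v ≤ b v) :
    ∑ᶠ v ∈ A, a v ≤ ∑ᶠ v ∈ A, b v := by
  classical
  rw [finsum_mem_eq_sum, finsum_mem_eq_sum]
  exact Finset.sum_le_sum fun v hv => h v (by simpa using hv)

lemma finsum_mem_modEq {A : Set V} {a b : V → ℤ} (h : ∀ v ∈ A, a v ≡ b v [ZMOD 2]) :
    ∑ᶠ v ∈ A, a v ≡ ∑ᶠ v ∈ A, b v [ZMOD 2] := by
  classical
  rw [finsum_mem_eq_sum, finsum_mem_eq_sum]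
  exact Int.ModEq.sum fun v hv => h v (by simpa using hv)

end Counting

section Necessity

variable {V : Type*} [Fintype V] {G : SimpleGraph V}

omit [Fintype V] in
lemma isCompSet_compSupp {A B : Set V} (c : (G.induce (A ∪ B)ᶜ).ConnectedComponent) :
    IsCompSet G (A ∪ B) (compSupp c) :=
  isCompSet_image_supp _ (fun _ _ => Iff.rfl) rfl c

omit [Fintype V] in
lemma compSupp_eq_of_mem {A B : Set V} {c d : (G.induce (A ∪ B)ᶜ).ConnectedComponent} {x : V}
    (hc : x ∈ compSupp c) (hd : x ∈ compSupp d) : c = d :=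
  image_supp_injective _ ((isCompSet_compSupp c).eq_of_mem (isCompSet_compSupp d) hc hd)

lemma deltaG_nonneg_of_isPPFactor {W : Set V} {g f : V → ℤ} {F : SimpleGraph V}
    (hF : IsPPFactor G F W g f) {A B : Set V} (hAB : Disjoint A B) :
    0 ≤ deltaG G W g f A B := by
  obtain ⟨hFG, hdeg, hpar⟩ := hF
  set R : Set V := (A ∪ B)ᶜ
  set Q : V → V → Prop := fun x y => G.Adj x y ∧ ¬ F.Adj x y
  have hAB' := Set.disjoint_left.1 hAB
  have hFG' : ∀ x y, F.Adj x y → G.Adj x y := fun x y h => hFG h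
  have hQs : ∀ x y, Q x y → Q y x := fun x y h => ⟨h.1.symm, fun h' => h.2 h'.symm⟩
  have hFs : ∀ x y, F.Adj x y → F.Adj y x := fun x y h => h.symm
  -- each counted component is joined to `A` in `F`, or to `B` in the complement of `F` in `G`
  have key : ∀ c : {c : (G.induce (A ∪ B)ᶜ).ConnectedComponent //
      (∀ v ∈ compSupp c \ W, g v = f v) ∧ IsOddComp G f A B c},
      ∃ p : V × V, p.1 ∈ compSupp c.1 ∧
        ((p.2 ∈ A ∧ F.Adj p.1 p.2) ∨ (p.2 ∈ B ∧ Q p.1 p.2)) := by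
    rintro ⟨c, hgf, hodd⟩
    have hD := isCompSet_compSupp c
    set D := compSupp c with hDdef
    have hDR : ∀ x ∈ D, x ∉ A ∧ x ∉ B := fun x hx => by simpa using hD.2.1.1 hx
    have hcl := hD.2.1.2
    unfold IsOddComp at hodd
    rw [eCnt_eq_pairCount, ← hDdef] at hodd
    have h1 : ∑ᶠ v ∈ D, f v ≡ ∑ᶠ v ∈ D, ((F.neighborSet v).ncard : ℤ) [ZMOD 2] := by
      refine finsum_mem_modEq fun v hv => ?_
      by_cases hvW : v ∈ W
      · exact (hpar v hvW).2.symm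
      · have := hgf v ⟨hv, hvW⟩
        have := hdeg v
        rw [show f v = ((F.neighborSet v).ncard : ℤ) by omega]
    rw [finsum_degree] at h1
    have h2 : pairCount F.Adj D Set.univ = pairCount F.Adj D D + pairCount F.Adj D (A ∪ B) := by
      refine pairCount_eq_add (fun x hx y => ?_) (fun x hx y hy _ hy' _ => hD.2.1.1 hy hy')
      have := hcl x hx y
      have := hFG' x y
      grind
    have h3 : pairCount F.Adj D (A ∪ B) = pairCount F.Adj D A + pairCount F.Adj D B :=
      pairCount_eq_add (fun x hx y => by grind) (fun x hx y hy _ hy' _ => hAB' hy hy')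
    have h4 : pairCount G.Adj D B = pairCount F.Adj D B + pairCount Q D B :=
      pairCount_eq_add (fun x hx y => by have := hFG' x y; grind) (fun x hx y hy _ hy' _ => by grind)
    have h5 := even_pairCount_self F D
    have h6 : pairCount F.Adj D A + pairCount Q D B ≠ 0 := by
      intro h0
      rw [Int.odd_iff] at hodd
      rw [Nat.even_iff] at h5
      unfold Int.ModEq at h1
      omega
    by_contra! hno
    apply h6
    rw [Nat.add_eq_zero_iff, pairCount, pairCount, Set.ncard_eq_zero, Set.ncard_eq_zero]
    constructor
    · ext p
      simp only [Set.mem_ofPred_eq, Set.mem_empty_iff_false, iff_false]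
      exact fun hp => (hno p hp.1).1 hp.2.1 hp.2.2
    · ext p
      simp only [Set.mem_ofPred_eq, Set.mem_empty_iff_false, iff_false]
      exact fun hp => (hno p hp.1).2 hp.2.1 hp.2.2
  choose φ hφ hφ' using key
  have hh : hWnum G W g f A B ≤ pairCount F.Adj R A + pairCount Q R B := by
    rw [hWnum, pairCount, pairCount]
    refine le_trans ?_ (Set.ncard_union_le _ _)
    rw [← Nat.card_coe_set_eq]
    refine Nat.card_le_card_of_injective (fun c => ⟨φ c, ?_⟩) ?_
    · have hc : (φ c).1 ∈ R := (isCompSet_compSupp c.1).2.1.1 (hφ c)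
      rcases hφ' c with h | h
      · exact Or.inl ⟨hc, h.1, h.2⟩
      · exact Or.inr ⟨hc, h.1, h.2⟩
    · intro c d hcd
      have := congrArg (fun p => p.1.1) hcd
      simp only at this
      exact Subtype.ext (compSupp_eq_of_mem (hφ c) (this ▸ hφ d))
  have e1 : ∑ᶠ v ∈ A, ((F.neighborSet v).ncard : ℤ) ≤ ∑ᶠ v ∈ A, f v :=
    finsum_mem_le_finsum_mem fun v _ => (hdeg v).2
  have e2 : ∑ᶠ v ∈ B, g v ≤ ∑ᶠ v ∈ B, ((F.neighborSet v).ncard : ℤ) :=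
    finsum_mem_le_finsum_mem fun v _ => (hdeg v).1
  rw [finsum_degree] at e1 e2
  have i1 : pairCount F.Adj A Set.univ = pairCount F.Adj A A + pairCount F.Adj A Aᶜ :=
    pairCount_eq_add (fun x hx y => by grind) (fun x hx y hy _ hy' _ => hy' hy)
  have i2 : pairCount F.Adj A Aᶜ = pairCount F.Adj A B + pairCount F.Adj A R :=
    pairCount_eq_add (fun x hx y => by have := @hAB' y; grind) (fun x hx y hy _ hy' _ => by grind)
  have i3 : pairCount F.Adj B Set.univ = pairCount F.Adj B A + pairCount F.Adj B Aᶜ :=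
    pairCount_eq_add (fun x hx y => by grind) (fun x hx y hy _ hy' _ => hy' hy)
  have i4 : pairCount G.Adj B Aᶜ = pairCount F.Adj B Aᶜ + pairCount Q B Aᶜ :=
    pairCount_eq_add (fun x hx y => by have := hFG' x y; grind) (fun x hx y hy _ hy' _ => by grind)
  have i5 : pairCount Q B R ≤ pairCount Q B Aᶜ := pairCount_mono (by grind)
  have i6 := pairCount_comm hFs A B
  have i7 := pairCount_comm hFs A R
  have i8 := pairCount_comm hQs B R
  rw [deltaG, finsum_degDel]
  omega

end Necessity

/-- The vertices of the auxiliary graph: the darts of `G`, `m v` mandatory and `o v` optional hubs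
at each vertex `v`, and `k + 1` additional vertices. -/
inductive Node {V : Type*} (G : SimpleGraph V) (m o : V → ℕ) (k : ℕ) where
  | dart (d : {p : V × V // G.Adj p.1 p.2})
  | core (c : Σ v, Fin (m v))
  | opt (c : Σ v, Fin (o v))
  | aux (i : Fin (k + 1))

/-- Adjacency in the auxiliary graph. -/
def nodeAdj {V : Type*} (G : SimpleGraph V) (W : Set V) (m o : V → ℕ) (k : ℕ) :
    Node G m o k → Node G m o k → Prop
  | .dart d, .dart e => e.1 = d.1.swap
  | .dart d, .core c => d.1.1 = c.1
  | .dart d, .opt c => d.1.1 = c.1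
  | .dart _, .aux _ => False
  | .core c, .dart d => d.1.1 = c.1
  | .core _, .core _ => False
  | .core _, .opt _ => False
  | .core _, .aux _ => False
  | .opt c, .dart d => d.1.1 = c.1
  | .opt _, .core _ => False
  | .opt c, .opt c' => c ≠ c' ∧ (c.1 = c'.1 ∨ c.1 ∉ W ∧ c'.1 ∉ W)
  | .opt c, .aux _ => c.1 ∉ W
  | .aux _, .dart _ => False
  | .aux _, .core _ => False
  | .aux _, .opt c => c.1 ∉ W
  | .aux i, .aux j => i ≠ j

/-- The auxiliary graph. Its perfect matchings encode the partial parity factors of `G`: each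
vertex `v` of `G` has its darts joined to all hubs at `v`, the optional hubs at `v ∈ W` form a
clique, and all other optional hubs together with the additional vertices form a clique. -/
def gadget {V : Type*} (G : SimpleGraph V) (W : Set V) (m o : V → ℕ) (k : ℕ) :
    SimpleGraph (Node G m o k) where
  Adj := nodeAdj G W m o k
  symm := ⟨by
    rintro (d | c | c | i) (d' | c' | c' | i') h <;> simp only [nodeAdj] at h ⊢
    · rw [h, Prod.swap_swap]
    all_goals first | exact h | grind⟩
  loopless := ⟨by
    rintro (d | c | c | i) h <;> simp only [nodeAdj] at h
    · have := d.2
      rw [Prod.ext_iff] at h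
      simp only [Prod.fst_swap, Prod.snd_swap] at h
      exact this.ne h.1
    · exact h.1 rfl
    · exact h rfl⟩

section Gadget

variable {V : Type*} {G : SimpleGraph V} {W : Set V} {m o : V → ℕ} {k : ℕ}

instance [Finite V] : Finite (Node G m o k) := by
  refine Finite.of_surjective
    (α := {p : V × V // G.Adj p.1 p.2} ⊕ (Σ v, Fin (m v)) ⊕ (Σ v, Fin (o v)) ⊕ Fin (k + 1))
    (Sum.elim Node.dart (Sum.elim Node.core (Sum.elim Node.opt Node.aux))) ?_
  rintro (d | c | c | i)
  · exact ⟨.inl d, rfl⟩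
  · exact ⟨.inr (.inl c), rfl⟩
  · exact ⟨.inr (.inr (.inl c)), rfl⟩
  · exact ⟨.inr (.inr (.inr i)), rfl⟩

lemma card_node [Finite V] : Nat.card (Node G m o k) =
    Nat.card ({p : V × V // G.Adj p.1 p.2} ⊕ (Σ v, Fin (m v)) ⊕ (Σ v, Fin (o v))) + (k + 1) := by
  rw [← Nat.card_fin (k + 1), ← Nat.card_sum]
  refine Nat.card_congr
    { toFun := fun x => match x with
        | .dart d => .inl (.inl d)
        | .core c => .inl (.inr (.inl c))
        | .opt c => .inl (.inr (.inr c))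
        | .aux i => .inr i
      invFun := fun x => match x with
        | .inl (.inl d) => .dart d
        | .inl (.inr (.inl c)) => .core c
        | .inl (.inr (.inr c)) => .opt c
        | .inr i => .aux i
      left_inv := by rintro (d | c | c | i) <;> rfl
      right_inv := by rintro ((d | c | c) | i) <;> rfl }

lemma exists_even_card_node [Finite V] : ∃ k, Even (Nat.card (Node G m o k)) := by
  by_cases h : Even (Nat.card (Node G m o 0))
  · exact ⟨0, h⟩
  · refine ⟨1, ?_⟩
    rw [card_node] at h ⊢
    grind

/-- The dart from `v` to `w` as a node. -/
abbrev Node.mkDart {v w : V} (h : G.Adj v w) : Node G m o k := .dart ⟨(v, w), h⟩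

/-- The hubs at `v`. -/
def hubs (G : SimpleGraph V) (m o : V → ℕ) (k : ℕ) (v : V) : Set (Node G m o k) :=
  {x | (∃ i, x = .core ⟨v, i⟩) ∨ ∃ i, x = .opt ⟨v, i⟩}

/-- The hubs and the darts at `v`. -/
def block (G : SimpleGraph V) (m o : V → ℕ) (k : ℕ) (v : V) : Set (Node G m o k) :=
  {x | x ∈ hubs G m o k v ∨ ∃ w, ∃ h : G.Adj v w, x = .mkDart h}

/-- Distinct neighbours, other than darts, of an optional hub or of an additional vertex are
adjacent to each other. -/
lemma adj_of_common_adj {y x x' : Node G m o k}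
    (hy : (∃ c, y = .opt c) ∨ ∃ i, y = .aux i)
    (hx : ∀ d, x ≠ .dart d) (hx' : ∀ d, x' ≠ .dart d)
    (hyx : (gadget G W m o k).Adj y x) (hyx' : (gadget G W m o k).Adj y x') (hne : x ≠ x') :
    (gadget G W m o k).Adj x x' := by
  obtain ⟨c, rfl⟩ | ⟨i, rfl⟩ := hy <;>
  rcases x with (d | d | d | d) <;> rcases x' with (d' | d' | d' | d') <;>
  simp only [gadget, nodeAdj] at * <;> grind

lemma adj_hub_dart_iff {v : V} {x : Node G m o k} (hx : x ∈ hubs G m o k v)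
    (d : {p : V × V // G.Adj p.1 p.2}) :
    (gadget G W m o k).Adj x (.dart d) ↔ d.1.1 = v := by
  obtain ⟨i, rfl⟩ | ⟨i, rfl⟩ := hx <;> rfl

lemma core_adj {c : Σ v, Fin (m v)} {x : Node G m o k}
    (h : (gadget G W m o k).Adj (.core c) x) : ∃ d, x = .dart d := by
  rcases x with (d | d | d | d) <;> first | exact ⟨d, rfl⟩ | exact h.elim

section Barrier

variable {S : Set (Node G m o k)} (hS : IsTight (gadget G W m o k) S)

include hS

lemma IsTight.aux_notMem (i : Fin (k + 1)) : .aux i ∉ S := by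
  intro hi
  obtain ⟨x₁, x₂, -, h₁, h₂, -, a₁, a₂, -, f, -⟩ := hS _ hi
  refine f.2.1 (adj_of_common_adj (.inr ⟨i, rfl⟩) ?_ ?_ a₁ a₂ f.1)
  · rintro d rfl; exact a₁
  · rintro d rfl; exact a₂

lemma IsTight.dart_mem {v w w' : V} (h : G.Adj v w) (h' : G.Adj v w')
    (hmem : Node.mkDart h ∈ S) : Node.mkDart h' ∈ S := by
  by_contra hn
  have key : ∀ x, (gadget G W m o k).Adj (.mkDart h) x → x = .mkDart h.symm ∨
      (gadget G W m o k).Adj x (.mkDart h') := by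
    rintro (d | c | c | i) hx <;> simp only [gadget, nodeAdj] at hx ⊢
    · left; rw [Node.dart.injEq]; exact Subtype.ext hx
    · exact .inr hx
    · exact .inr hx
  obtain ⟨x₁, x₂, x₃, h₁, h₂, h₃, a₁, a₂, a₃, f₁, f₂, f₃⟩ := hS _ hmem
  have key2 : ∀ x y, Far (gadget G W m o k) S x y → (gadget G W m o k).Adj x (.mkDart h') →
      ¬ (gadget G W m o k).Adj y (.mkDart h') := fun x y f ax ay => f.2.2 _ hn ax ay.symm
  have := f₁.1
  have := f₂.1
  have := f₃.1
  have := key _ a₁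
  have := key _ a₂
  have := key _ a₃
  have := key2 _ _ f₁
  have := key2 _ _ f₂
  have := key2 _ _ f₃
  grind

lemma IsTight.pos_of_dart_mem {v w : V} (h : G.Adj v w) (hmem : Node.mkDart h ∈ S) :
    0 < m v := by
  by_contra hm
  have key : ∀ x, (gadget G W m o k).Adj (.mkDart h) x → x = .mkDart h.symm ∨
      ∃ i, x = .opt ⟨v, i⟩ := by
    rintro (d | c | c | i) hx <;> simp only [gadget, nodeAdj] at hx
    · left; rw [Node.dart.injEq]; exact Subtype.ext hx
    · obtain ⟨u, i⟩ := c
      subst hx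
      exact absurd i.pos hm
    · obtain ⟨u, i⟩ := c
      subst hx
      exact .inr ⟨i, rfl⟩
  have key2 : ∀ x y, Far (gadget G W m o k) S x y → (∃ i, x = .opt ⟨v, i⟩) →
      ¬ ∃ i, y = .opt ⟨v, i⟩ := by
    rintro x y f ⟨i, rfl⟩ ⟨j, rfl⟩
    refine f.2.1 ⟨fun hij => f.1 (by rw [hij]), .inl rfl⟩
  obtain ⟨x₁, x₂, x₃, h₁, h₂, h₃, a₁, a₂, a₃, f₁, f₂, f₃⟩ := hS _ hmem
  have := f₁.1
  have := f₂.1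
  have := f₃.1
  have := key _ a₁
  have := key _ a₂
  have := key _ a₃
  have := key2 _ _ f₁
  have := key2 _ _ f₂
  have := key2 _ _ f₃
  grind

lemma IsTight.dart_notMem {v w : V} {x : Node G m o k} (hx : x ∈ hubs G m o k v) (hxS : x ∈ S)
    (h : G.Adj v w) : Node.mkDart h ∉ S := by
  intro hmem
  have hd : ∀ y ∉ S, (gadget G W m o k).Adj x y → ∀ d, y ≠ .dart d := by
    rintro _ hyS hxy ⟨⟨v', w'⟩, h'⟩ rfl
    obtain rfl : v' = v := (adj_hub_dart_iff hx _).1 hxy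
    exact hyS (hS.dart_mem h h' hmem)
  obtain ⟨x₁, x₂, -, h₁, h₂, -, a₁, a₂, -, f, -⟩ := hS _ hxS
  obtain ⟨i, rfl⟩ | ⟨i, rfl⟩ := hx
  · obtain ⟨d, rfl⟩ := core_adj a₁
    exact hd _ h₁ a₁ d rfl
  · exact f.2.1 (adj_of_common_adj (.inl ⟨_, rfl⟩) (hd _ h₁ a₁) (hd _ h₂ a₂) a₁ a₂ f.1)

/-- If a hub at `v` belongs to `S`, then so do all hubs at `v`. -/
lemma IsTight.hub_mem {v : V} {x y : Node G m o k} (hx : x ∈ hubs G m o k v)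
    (hy : y ∈ hubs G m o k v) (hxS : x ∈ S) : y ∈ S := by
  by_contra hyS
  have hd : ∀ z z', (gadget G W m o k).Adj x z → (gadget G W m o k).Adj x z' →
      Far (gadget G W m o k) S z z' → (∃ d, z = .dart d) → (∃ d, z' = .dart d) → False := by
    rintro _ _ a a' f ⟨d, rfl⟩ ⟨d', rfl⟩
    rw [adj_hub_dart_iff hx] at a a'
    exact f.2.2 y hyS ((adj_hub_dart_iff hy _).2 a).symm ((adj_hub_dart_iff hy _).2 a')
  have ho : ∀ z z', (gadget G W m o k).Adj x z → (gadget G W m o k).Adj x z' →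
      Far (gadget G W m o k) S z z' → (¬ ∃ d, z = .dart d) → (¬ ∃ d, z' = .dart d) → False := by
    intro z z' a a' f hz hz'
    obtain ⟨i, rfl⟩ | ⟨i, rfl⟩ := hx
    · exact hz (core_adj a)
    · exact f.2.1 (adj_of_common_adj (.inl ⟨_, rfl⟩) (not_exists.1 hz) (not_exists.1 hz') a a' f.1)
  obtain ⟨x₁, x₂, x₃, h₁, h₂, h₃, a₁, a₂, a₃, f₁, f₂, f₃⟩ := hS _ hxS
  have := hd _ _ a₁ a₂ f₁
  have := hd _ _ a₁ a₃ f₂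
  have := hd _ _ a₂ a₃ f₃
  have := ho _ _ a₁ a₂ f₁
  have := ho _ _ a₁ a₃ f₂
  have := ho _ _ a₂ a₃ f₃
  tauto

end Barrier

lemma ncard_sigma_fin [Fintype V] (n : V → ℕ) (A : Set V) :
    ({c : Σ v, Fin (n v) | c.1 ∈ A}.ncard : ℤ) = ∑ᶠ v ∈ A, (n v : ℤ) := by
  classical
  rw [finsum_mem_eq_sum, Set.ncard_eq_toFinset_card', ← Nat.cast_sum]
  congr 1
  have : {c : Σ v, Fin (n v) | c.1 ∈ A}.toFinset =
      (Finset.univ.filter (· ∈ A)).sigma fun _ => Finset.univ := by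
    ext; simp
  rw [this, Finset.card_sigma]
  simp

lemma ncard_hubs_at [Fintype V] (B : Set V) :
    ({x : Node G m o k | ∃ v ∈ B, x ∈ hubs G m o k v}.ncard : ℤ) =
      ∑ᶠ v ∈ B, ((m v : ℤ) + o v) := by
  have h : {x : Node G m o k | ∃ v ∈ B, x ∈ hubs G m o k v} =
      Node.core '' {c | c.1 ∈ B} ∪ Node.opt '' {c | c.1 ∈ B} := by
    ext x
    simp only [hubs, Set.mem_ofPred_eq, Set.mem_union, Set.mem_image]
    constructor
    · rintro ⟨v, hv, ⟨i, rfl⟩ | ⟨i, rfl⟩⟩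
      · exact .inl ⟨_, hv, rfl⟩
      · exact .inr ⟨_, hv, rfl⟩
    · rintro (⟨c, hc, rfl⟩ | ⟨c, hc, rfl⟩)
      · exact ⟨c.1, hc, .inl ⟨c.2, rfl⟩⟩
      · exact ⟨c.1, hc, .inr ⟨c.2, rfl⟩⟩
  rw [h, Set.ncard_union_eq, Set.ncard_image_of_injective _ (fun a b h => by simpa using h),
    Set.ncard_image_of_injective _ (fun a b h => by simpa using h), Nat.cast_add,
    ncard_sigma_fin, ncard_sigma_fin, finsum_mem_add_distrib (Set.toFinite _)]
  rw [Set.disjoint_left]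
  rintro _ ⟨c, -, rfl⟩ ⟨d, -, h⟩
  simp at h

lemma ncard_darts_at [Fintype V] (A B : Set V) :
    {x : Node G m o k | ∃ v ∈ A, ∃ w ∈ B, ∃ h : G.Adj v w, x = .mkDart h}.ncard =
      pairCount G.Adj A B := by
  symm
  refine Set.ncard_congr (fun p hp => Node.dart ⟨p, hp.2.2⟩) ?_ ?_ ?_
  · rintro ⟨v, w⟩ ⟨h1, h2, h3⟩
    exact ⟨v, h1, w, h2, h3, rfl⟩
  · intro a b _ _ h
    simpa using h
  · rintro _ ⟨v, h1, w, h2, h3, rfl⟩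
    exact ⟨(v, w), ⟨h1, h2, h3⟩, rfl⟩

lemma ncard_le_of_rel {α β : Type*} [Finite β] {s : Set α} (T : Set β) (r : α → β → Prop)
    (h : ∀ a ∈ s, ∃ t ∈ T, r a t) (hr : ∀ a ∈ s, ∀ a' ∈ s, ∀ t ∈ T, r a t → r a' t → a = a') :
    s.ncard ≤ T.ncard := by
  rcases s.eq_empty_or_nonempty with rfl | ⟨a₀, ha₀⟩
  · simp
  have : Nonempty β := ⟨(h a₀ ha₀).choose⟩
  choose! φ hφ hr' using h
  exact Set.ncard_le_ncard_of_injOn φ hφ fun a ha a' ha' e =>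
    hr a ha a' ha' _ (hφ a ha) (hr' a ha) (e ▸ hr' a' ha')

end Gadget

section BarrierBound

variable {V : Type*} {G : SimpleGraph V} {W : Set V} {m o : V → ℕ} {k : ℕ}
  {S : Set (Node G m o k)}

/-- The vertices of `G` with a dart in the barrier. -/
def dartSide (S : Set (Node G m o k)) : Set V :=
  {v | ∃ w, ∃ h : G.Adj v w, Node.mkDart h ∈ S}

/-- The vertices of `G` all of whose hubs, but none of whose darts, are in the barrier. -/
def hubSide (S : Set (Node G m o k)) : Set V :=
  {v | v ∉ dartSide S ∧ hubs G m o k v ⊆ S}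

lemma disjoint_dartSide_hubSide : Disjoint (dartSide S) (hubSide S) :=
  Set.disjoint_left.2 fun _ hA hB => hB.1 hA

lemma mkDart_notMem {v w : V} (hv : v ∉ dartSide S) (h : G.Adj v w) : Node.mkDart h ∉ S :=
  fun hm => hv ⟨w, h, hm⟩

lemma IsTight.mkDart_mem (hS : IsTight (gadget G W m o k) S) {v w : V} (hv : v ∈ dartSide S)
    (h : G.Adj v w) : Node.mkDart h ∈ S := by
  obtain ⟨w', h', hm⟩ := hv
  exact hS.dart_mem h' h hm

lemma IsTight.hub_notMem (hS : IsTight (gadget G W m o k) S) {v : V} (hv : v ∉ hubSide S)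
    {x : Node G m o k} (hx : x ∈ hubs G m o k v) : x ∉ S := by
  intro hxS
  refine hv ⟨?_, fun y hy => hS.hub_mem hx hy hxS⟩
  rintro ⟨w, h, hm⟩
  exact hS.dart_notMem hx hxS h hm

lemma exists_hub {v : V} (hv : v ∉ dartSide S ∪ hubSide S) : ∃ x, x ∈ hubs G m o k v := by
  by_contra! h
  exact hv (.inr ⟨fun hA => hv (.inl hA), fun x hx => absurd hx (h x)⟩)

lemma IsTight.block_notMem (hS : IsTight (gadget G W m o k) S) {v : V}
    (hv : v ∉ dartSide S ∪ hubSide S) {x : Node G m o k} (hx : x ∈ block G m o k v) : x ∉ S := by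
  rw [Set.mem_union, not_or] at hv
  obtain hx | ⟨w, h, rfl⟩ := hx
  · exact hS.hub_notMem hv.2 hx
  · exact mkDart_notMem hv.1 h

/-- A component meeting the block of a vertex outside both sides contains the whole block. -/
lemma IsTight.block_subset (hS : IsTight (gadget G W m o k) S)
    (hm : ∀ v, 0 < m v → ∃ w, G.Adj v w) {v : V} (hv : v ∉ dartSide S ∪ hubSide S)
    {K : Set (Node G m o k)} (hK : IsClosedOff (gadget G W m o k) S K) {x : Node G m o k}
    (hxK : x ∈ K) (hx : x ∈ block G m o k v) : block G m o k v ⊆ K := by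
  have hb := fun y => hS.block_notMem hv (x := y)
  have hub_of_dart : ∀ w (h : G.Adj v w), Node.mkDart h ∈ K → hubs G m o k v ⊆ K := by
    intro w h hd y hy
    exact hK.2 _ hd y (hb y (.inl hy)) ((adj_hub_dart_iff hy _).2 rfl).symm
  have dart_of_hub : ∀ y ∈ hubs G m o k v, y ∈ K → ∀ w (h : G.Adj v w), Node.mkDart h ∈ K := by
    intro y hy hyK w h
    exact hK.2 _ hyK _ (hb _ (.inr ⟨w, h, rfl⟩)) ((adj_hub_dart_iff hy _).2 rfl)
  obtain ⟨y₀, hy₀⟩ := exists_hub hv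
  have hhub : ∃ y ∈ hubs G m o k v, y ∈ K := by
    obtain hx | ⟨w, h, rfl⟩ := hx
    · exact ⟨x, hx, hxK⟩
    · exact ⟨y₀, hy₀, hub_of_dart w h hxK hy₀⟩
  obtain ⟨y, hy, hyK⟩ := hhub
  rintro z (hz | ⟨w, h, rfl⟩)
  · by_cases hd : ∃ w, G.Adj v w
    · obtain ⟨w, h⟩ := hd
      exact hub_of_dart w h (dart_of_hub y hy hyK w h) hz
    · have hnc : ∀ i : Fin (m v), False := fun i => hd (hm v i.pos)
      by_cases hyz : y = z
      · exact hyz ▸ hyK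
      refine hK.2 y hyK z (hb z (.inl hz)) ?_
      obtain ⟨i, rfl⟩ | ⟨i, rfl⟩ := hy
      · exact (hnc i).elim
      obtain ⟨j, rfl⟩ | ⟨j, rfl⟩ := hz
      · exact (hnc j).elim
      exact ⟨fun h => hyz (by rw [h]), .inl rfl⟩
  · exact dart_of_hub y hy hyK w h

/-- Blocks of a component of `G − (A ∪ B)` lie in a single component of the auxiliary graph. -/
lemma IsTight.block_subset_of_mem (hS : IsTight (gadget G W m o k) S)
    (hm : ∀ v, 0 < m v → ∃ w, G.Adj v w) {D : Set V}
    (hD : IsCompSet G (dartSide S ∪ hubSide S) D)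
    {K : Set (Node G m o k)} (hK : IsClosedOff (gadget G W m o k) S K) {v : V} (hv : v ∈ D)
    {x : Node G m o k} (hxK : x ∈ K) (hx : x ∈ block G m o k v) :
    ∀ u ∈ D, block G m o k u ⊆ K := by
  have hcl : IsClosedOff G (dartSide S ∪ hubSide S)
      {u | u ∉ dartSide S ∪ hubSide S ∧ block G m o k u ⊆ K} := by
    refine ⟨fun u hu => hu.1, fun u hu w hw huw => ⟨hw, ?_⟩⟩
    have h1 : Node.mkDart huw ∈ K := hu.2 (.inr ⟨w, huw, rfl⟩)
    have hb : Node.mkDart huw.symm ∈ block G m o k w := .inr ⟨u, huw.symm, rfl⟩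
    have h2 : Node.mkDart huw.symm ∈ K := hK.2 _ h1 _ (hS.block_notMem hw hb) rfl
    exact hS.block_subset hm hw hK h2 hb
  have hvn : v ∉ dartSide S ∪ hubSide S := hD.2.1.1 hv
  exact fun u hu => (hD.subset_of_isClosedOff hcl hv ⟨hvn, hS.block_subset hm hvn hK hxK hx⟩ hu).2

/-- The exact vertex set of a component which meets a block and avoids the additional vertices. -/
lemma IsTight.eq_of_aux_notMem (hS : IsTight (gadget G W m o k) S)
    (hm : ∀ v, 0 < m v → ∃ w, G.Adj v w) {D : Set V}
    (hD : IsCompSet G (dartSide S ∪ hubSide S) D)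
    {K : Set (Node G m o k)} (hK : IsCompSet (gadget G W m o k) S K) {v : V} (hv : v ∈ D)
    {x : Node G m o k} (hxK : x ∈ K) (hx : x ∈ block G m o k v) (haux : ∀ i, .aux i ∉ K) :
    K = {y | ∃ u ∈ D, y ∈ hubs G m o k u} ∪
      ({y | ∃ u ∈ D, ∃ w ∈ Set.univ, ∃ h : G.Adj u w, y = .mkDart h} ∪
        {y | ∃ w ∈ hubSide S, ∃ u ∈ D, ∃ h : G.Adj w u, y = .mkDart h}) := by
  have hsub := hS.block_subset_of_mem hm hD hK.2.1 hv hxK hx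
  have hDn : ∀ u ∈ D, u ∉ dartSide S ∪ hubSide S := fun u hu => hD.2.1.1 hu
  have hoptW : ∀ c, Node.opt c ∈ K → c.1 ∈ W := by
    intro c hc
    by_contra hW
    exact haux 0 (hK.2.1.2 _ hc (.aux 0) (hS.aux_notMem 0) hW)
  set L := {y | ∃ u ∈ D, y ∈ hubs G m o k u} ∪
      ({y | ∃ u ∈ D, ∃ w ∈ Set.univ, ∃ h : G.Adj u w, y = .mkDart h} ∪
        {y | ∃ w ∈ hubSide S, ∃ u ∈ D, ∃ h : G.Adj w u, y = .mkDart h})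
  have hblockL : ∀ u ∈ D, block G m o k u ⊆ L := by
    rintro u hu y (hy | ⟨w, h, rfl⟩)
    · exact .inl ⟨u, hu, hy⟩
    · exact .inr (.inl ⟨u, hu, w, trivial, h, rfl⟩)
  have hcl : IsClosedOff (gadget G W m o k) S (K ∩ L) := by
    refine ⟨fun y hy => hK.2.1.1 hy.1, fun y hy z hz hyz => ⟨hK.2.1.2 y hy.1 z hz hyz, ?_⟩⟩
    obtain ⟨hyK, ⟨u, hu, hyu⟩ | ⟨u, hu, w, -, h, rfl⟩ | ⟨w, hw, u, hu, h, rfl⟩⟩ := hy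
    · rcases z with (⟨⟨u', w⟩, h⟩ | c | c | i)
      · obtain rfl : u' = u := (adj_hub_dart_iff hyu _).1 hyz
        exact hblockL u' hu (.inr ⟨w, h, rfl⟩)
      · obtain ⟨i, rfl⟩ | ⟨i, rfl⟩ := hyu <;> exact hyz.elim
      · obtain ⟨i, rfl⟩ | ⟨i, rfl⟩ := hyu
        · exact hyz.elim
        · obtain ⟨-, h | h⟩ := hyz
          · obtain ⟨u', j⟩ := c
            obtain rfl : u = u' := h
            exact hblockL u hu (.inl (.inr ⟨j, rfl⟩))
          · exact absurd (hoptW _ hyK) h.1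
      · obtain ⟨i, rfl⟩ | ⟨i, rfl⟩ := hyu
        · exact hyz.elim
        · exact absurd (hoptW _ hyK) hyz
    · rcases z with (⟨p, h'⟩ | c | c | i)
      · obtain rfl : p = (w, u) := hyz
        by_cases hwA : w ∈ dartSide S
        · exact absurd (hS.mkDart_mem hwA h') hz
        by_cases hwB : w ∈ hubSide S
        · exact .inr (.inr ⟨w, hwB, u, hu, h', rfl⟩)
        have hwD : w ∈ D := hD.2.1.2 u hu w (by simp [hwA, hwB]) h
        exact hblockL w hwD (.inr ⟨u, h', rfl⟩)
      · obtain ⟨u', i⟩ := c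
        obtain rfl : u = u' := hyz
        exact hblockL u hu (.inl (.inl ⟨i, rfl⟩))
      · obtain ⟨u', i⟩ := c
        obtain rfl : u = u' := hyz
        exact hblockL u hu (.inl (.inr ⟨i, rfl⟩))
      · exact hyz.elim
    · rcases z with (⟨p, h'⟩ | c | c | i)
      · obtain rfl : p = (u, w) := hyz
        exact hblockL u hu (.inr ⟨w, h', rfl⟩)
      · obtain ⟨u', i⟩ := c
        obtain rfl : w = u' := hyz
        exact absurd (hw.2 (.inl ⟨i, rfl⟩)) hz
      · obtain ⟨u', i⟩ := c
        obtain rfl : w = u' := hyz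
        exact absurd (hw.2 (.inr ⟨i, rfl⟩)) hz
      · exact hyz.elim
  have hKL := hK.2.2 (K ∩ L) Set.inter_subset_left ⟨x, hxK, hblockL v hv hx⟩ hcl
  refine (Set.inter_eq_left.1 hKL).antisymm ?_
  rintro y (⟨u, hu, hyu⟩ | ⟨u, hu, w, -, h, rfl⟩ | ⟨w, hw, u, hu, h, rfl⟩)
  · exact hsub u hu (.inl hyu)
  · exact hsub u hu (.inr ⟨w, h, rfl⟩)
  · have h1 : Node.mkDart h.symm ∈ K := hsub u hu (.inr ⟨w, h.symm, rfl⟩)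
    exact hK.2.1.2 _ h1 _ (mkDart_notMem hw.1 h) rfl

end BarrierBound

section BarrierCount

variable {V : Type*} [Fintype V] {G : SimpleGraph V} {W : Set V} {m o : V → ℕ} {k : ℕ}
  {S : Set (Node G m o k)} {g f : V → ℤ}

/-- The size of the barrier. -/
lemma IsTight.le_ncard (hS : IsTight (gadget G W m o k) S) :
    (pairCount G.Adj (dartSide S) Set.univ : ℤ) + ∑ᶠ v ∈ hubSide S, ((m v : ℤ) + o v) ≤
      S.ncard := by
  rw [← ncard_hubs_at (G := G) (k := k), ← ncard_darts_at (m := m) (o := o) (k := k),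
    ← Nat.cast_add, ← Set.ncard_union_eq]
  · refine Nat.cast_le.2 (Set.ncard_le_ncard ?_)
    rintro x (⟨v, hv, w, -, h, rfl⟩ | ⟨v, hv, hx⟩)
    · exact hS.mkDart_mem hv h
    · exact hv.2 hx
  · rw [Set.disjoint_left]
    rintro _ ⟨v, hv, w, -, h, rfl⟩ ⟨v', hv', ⟨i, hi⟩ | ⟨i, hi⟩⟩ <;> cases hi

/-- The parity of a component which meets a block and avoids the additional vertices. -/
lemma IsTight.isOddComp (hS : IsTight (gadget G W m o k) S)
    (hm : ∀ v, 0 < m v → ∃ w, G.Adj v w)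
    (hmo : ∀ v, (m v + o v : ℤ) = (G.neighborSet v).ncard - g v)
    (c : (G.induce (dartSide S ∪ hubSide S)ᶜ).ConnectedComponent)
    (hgf : ∀ v ∈ compSupp c, g v ≡ f v [ZMOD 2])
    {K : Set (Node G m o k)} (hK : K ∈ oddCompSets (gadget G W m o k) S) {v : V}
    (hv : v ∈ compSupp c) {x : Node G m o k} (hxK : x ∈ K) (hx : x ∈ block G m o k v)
    (haux : ∀ i, .aux i ∉ K) :
    IsOddComp G f (dartSide S) (hubSide S) c := by
  have hD := isCompSet_compSupp c
  unfold IsOddComp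
  set D := compSupp c
  have hKeq := hS.eq_of_aux_notMem hm hD hK.1 hv hxK hx haux
  have hcard : (K.ncard : ℤ) = ∑ᶠ v ∈ D, ((m v : ℤ) + o v) +
      (pairCount G.Adj D Set.univ + pairCount G.Adj (hubSide S) D) := by
    rw [hKeq, Set.ncard_union_eq, Set.ncard_union_eq, ncard_darts_at, ncard_darts_at]
    · rw [Nat.cast_add, ncard_hubs_at, Nat.cast_add]
    · rw [Set.disjoint_left]
      rintro _ ⟨u, hu, w, -, h, rfl⟩ ⟨u', hu', w', hw', h', he⟩
      cases he
      exact hD.2.1.1 hu (.inr hu')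
    · rw [Set.disjoint_left]
      rintro _ ⟨u, hu, ⟨i, rfl⟩ | ⟨i, rfl⟩⟩ (⟨u', hu', w', -, h', he⟩ | ⟨u', hu', w', hw', h', he⟩) <;>
        cases he
  have h1 : ∑ᶠ v ∈ D, ((m v : ℤ) + o v) = pairCount G.Adj D Set.univ - ∑ᶠ v ∈ D, g v := by
    rw [← finsum_degree, ← finsum_mem_sub_distrib _ _ (Set.toFinite _)]
    exact finsum_mem_congr rfl fun v _ => hmo v
  have h2 := finsum_mem_modEq hgf
  have h3 := pairCount_comm (fun x y (h : G.Adj x y) => h.symm) (hubSide S) D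
  have hodd := hK.2
  rw [eCnt_eq_pairCount]
  rw [Int.odd_iff]
  rw [Nat.odd_iff] at hodd
  unfold Int.ModEq at h2
  omega

/-- The classification of the odd components of the auxiliary graph. -/
lemma IsTight.oddComp_cases (hS : IsTight (gadget G W m o k) S)
    (hm : ∀ v, 0 < m v → ∃ w, G.Adj v w)
    (hmo : ∀ v, (m v + o v : ℤ) = (G.neighborSet v).ncard - g v)
    (hmf : ∀ v, (m v : ℤ) = max ((G.neighborSet v).ncard - f v) 0)
    (hgf : ∀ v, g v ≤ f v) (hpar : ∀ v ∈ W, g v ≡ f v [ZMOD 2])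
    {K : Set (Node G m o k)} (hK : K ∈ oddCompSets (gadget G W m o k) S) :
    (∃ c : Σ v, Fin (m v), c.1 ∈ dartSide S ∧ .core c ∈ K) ∨
    (∃ v w, ∃ h : G.Adj v w, v ∈ hubSide S ∧ w ∈ dartSide S ∧ .mkDart h ∈ K) ∨
    (∃ c : (G.induce (dartSide S ∪ hubSide S)ᶜ).ConnectedComponent,
      ((∀ v ∈ compSupp c \ W, g v = f v) ∧ IsOddComp G f (dartSide S) (hubSide S) c) ∧
      ∃ v ∈ compSupp c, ∃ x ∈ block G m o k v, x ∈ K) ∨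
    .aux 0 ∈ K := by
  by_cases haux0 : .aux 0 ∈ K
  · exact .inr (.inr (.inr haux0))
  have haux : ∀ i, .aux i ∉ K := by
    intro i hi
    by_cases h : i = 0
    · exact haux0 (h ▸ hi)
    · exact haux0 (hK.1.2.1.2 _ hi _ (hS.aux_notMem 0) h)
  have hoptW : ∀ c, Node.opt c ∈ K → c.1 ∈ W := by
    intro c hc
    by_contra hW
    exact haux 0 (hK.1.2.1.2 _ hc (.aux 0) (hS.aux_notMem 0) hW)
  by_cases hblock : ∃ v, v ∉ dartSide S ∪ hubSide S ∧ ∃ x ∈ block G m o k v, x ∈ K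
  · obtain ⟨v, hv, x, hx, hxK⟩ := hblock
    refine .inr (.inr (.inl ?_))
    set c := (G.induce (dartSide S ∪ hubSide S)ᶜ).connectedComponentMk ⟨v, hv⟩
    have hvc : v ∈ compSupp c := ⟨⟨v, hv⟩, rfl, rfl⟩
    have heq : ∀ u ∈ compSupp c \ W, g u = f u := by
      rintro u ⟨hu, huW⟩
      by_contra hne
      have hsub := hS.block_subset_of_mem hm (isCompSet_compSupp c) hK.1.2.1 hvc hxK hx u hu
      have hun : u ∉ dartSide S ∪ hubSide S := (isCompSet_compSupp c).2.1.1 hu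
      obtain ⟨y, hy⟩ := exists_hub hun
      have hpos : 0 < m u + o u := by
        obtain ⟨i, -⟩ | ⟨i, -⟩ := hy <;> have := i.pos <;> omega
      have h1 := hmo u
      have h2 := hmf u
      have h3 := hgf u
      have ho : 0 < o u := by omega
      exact huW (hoptW ⟨u, ⟨0, ho⟩⟩ (hsub (.inl (.inr ⟨_, rfl⟩))))
    refine ⟨c, ⟨heq, ?_⟩, v, hvc, x, hx, hxK⟩
    refine hS.isOddComp hm hmo c (fun u hu => ?_) hK hvc hxK hx haux
    by_cases huW : u ∈ W
    · exact hpar u huW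
    · rw [heq u ⟨hu, huW⟩]
  push Not at hblock
  obtain ⟨x, hxK⟩ := hK.1.1
  have hxS : x ∉ S := hK.1.2.1.1 hxK
  have hside : ∀ v, x ∈ hubs G m o k v → v ∈ dartSide S := by
    intro v hx
    by_contra hv
    by_cases hvB : v ∈ hubSide S
    · exact hxS (hvB.2 hx)
    · exact hblock v (by simp [hv, hvB]) x (.inl hx) hxK
  rcases x with (⟨⟨v, w⟩, h⟩ | ⟨v, i⟩ | ⟨v, i⟩ | i)
  · have hvA : v ∉ dartSide S := fun hv => hxS (hS.mkDart_mem hv h)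
    have hvB : v ∈ hubSide S := by
      by_contra hvB
      exact hblock v (by simp [hvA, hvB]) _ (.inr ⟨w, h, rfl⟩) hxK
    by_cases hwA : w ∈ dartSide S
    · exact .inr (.inl ⟨v, w, h, hvB, hwA, hxK⟩)
    exfalso
    have hsK : Node.mkDart h.symm ∈ K := hK.1.2.1.2 _ hxK _ (mkDart_notMem hwA _) rfl
    have hwB : w ∈ hubSide S := by
      by_contra hwB
      exact hblock w (by simp [hwA, hwB]) _ (.inr ⟨v, h.symm, rfl⟩) hsK
    have hnbr : ∀ {a b : V} (hab : G.Adj a b), a ∈ hubSide S → ∀ z ∉ S,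
        (gadget G W m o k).Adj (.mkDart hab) z → z = .mkDart hab.symm := by
      rintro a b hab ha (⟨p, h'⟩ | ⟨u, i⟩ | ⟨u, i⟩ | i) hz hadj
      · obtain rfl : p = (b, a) := hadj
        rfl
      · obtain rfl : a = u := hadj
        exact absurd (ha.2 (.inl ⟨i, rfl⟩)) hz
      · obtain rfl : a = u := hadj
        exact absurd (ha.2 (.inr ⟨i, rfl⟩)) hz
      · exact hadj.elim
    have hpair : {Node.mkDart h, Node.mkDart h.symm} = K := by
      refine hK.1.2.2 _ ?_ ⟨_, .inl rfl⟩ ⟨?_, ?_⟩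
      · rintro y (rfl | rfl)
        exacts [hxK, hsK]
      · rintro y (rfl | rfl)
        exacts [hxS, hK.1.2.1.1 hsK]
      · rintro y (rfl | rfl) z hz hyz
        · exact .inr (hnbr h hvB z hz hyz)
        · exact .inl (hnbr h.symm hwB z hz hyz)
    have hodd := hK.2
    rw [← hpair, Set.ncard_pair] at hodd
    · exact absurd hodd (by decide)
    · intro he
      cases he
      exact h.ne rfl
  · exact .inl ⟨⟨v, i⟩, hside v (.inl ⟨i, rfl⟩), hxK⟩
  · exfalso
    have hvA := hside v (.inr ⟨i, rfl⟩)
    have hvW : v ∈ W := hoptW _ hxK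
    have hvB : v ∉ hubSide S := fun h => h.1 hvA
    have hclique : Node.opt '' {c : Σ v, Fin (o v) | c.1 ∈ ({v} : Set V)} = K := by
      refine hK.1.2.2 _ ?_ ⟨_, ⟨v, i⟩, rfl, rfl⟩ ⟨?_, ?_⟩
      · rintro _ ⟨⟨u, j⟩, hu, rfl⟩
        obtain rfl : u = v := hu
        by_cases hij : i = j
        · exact hij ▸ hxK
        · refine hK.1.2.1.2 _ hxK _ (hS.hub_notMem hvB (.inr ⟨j, rfl⟩)) ⟨?_, .inl rfl⟩
          intro h
          cases h
          exact hij rfl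
      · rintro _ ⟨⟨u, j⟩, hu, rfl⟩
        obtain rfl : u = v := hu
        exact hS.hub_notMem hvB (.inr ⟨j, rfl⟩)
      · rintro _ ⟨⟨u, j⟩, hu, rfl⟩ (⟨⟨a, b⟩, h⟩ | c | c | l) hz hyz
        · obtain rfl : u = v := hu
          obtain rfl : a = u := hyz
          exact absurd (hS.mkDart_mem hvA h) hz
        · exact hyz.elim
        · refine ⟨c, ?_, rfl⟩
          obtain rfl : u = v := hu
          exact (hyz.2.resolve_right fun h => h.1 hvW).symm
        · obtain rfl : u = v := hu
          exact absurd hvW hyz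
    obtain ⟨w, h, hmem⟩ := hvA
    have hpos := hS.pos_of_dart_mem h hmem
    have hodd := hK.2
    have hcard : (K.ncard : ℤ) = o v := by
      rw [← hclique, Set.ncard_image_of_injective _ (fun a b h => by simpa using h),
        ncard_sigma_fin, finsum_mem_singleton]
    have h1 := hmo v
    have h2 := hmf v
    have h3 := hpar v hvW
    unfold Int.ModEq at h3
    rw [Nat.odd_iff] at hodd
    omega
  · exact absurd hxK (haux i)

/-- The number of odd components of the auxiliary graph. -/
lemma IsTight.ncard_oddCompSets_le (hS : IsTight (gadget G W m o k) S)
    (hm : ∀ v, 0 < m v → ∃ w, G.Adj v w)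
    (hmo : ∀ v, (m v + o v : ℤ) = (G.neighborSet v).ncard - g v)
    (hmf : ∀ v, (m v : ℤ) = max ((G.neighborSet v).ncard - f v) 0)
    (hgf : ∀ v, g v ≤ f v) (hpar : ∀ v ∈ W, g v ≡ f v [ZMOD 2]) :
    ((oddCompSets (gadget G W m o k) S).ncard : ℤ) ≤ ∑ᶠ v ∈ dartSide S, (m v : ℤ) +
      pairCount G.Adj (hubSide S) (dartSide S) +
      hWnum G W g f (dartSide S) (hubSide S) + 1 := by
  set O := oddCompSets (gadget G W m o k) S
  set A := dartSide S
  set B := hubSide S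
  set H : Set (G.induce (A ∪ B)ᶜ).ConnectedComponent :=
    {c | (∀ v ∈ compSupp c \ W, g v = f v) ∧ IsOddComp G f A B c}
  set O₁ := {K ∈ O | ∃ c : Σ v, Fin (m v), c.1 ∈ A ∧ .core c ∈ K}
  set O₂ := {K ∈ O | ∃ v w, ∃ h : G.Adj v w, v ∈ B ∧ w ∈ A ∧ .mkDart h ∈ K}
  set O₃ := {K ∈ O | ∃ c ∈ H, ∃ v ∈ compSupp c, ∃ x ∈ block G m o k v, x ∈ K}
  set O₄ := {K ∈ O | .aux 0 ∈ K}
  have hcover : O ⊆ O₁ ∪ (O₂ ∪ (O₃ ∪ O₄)) := by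
    intro K hK
    obtain h | h | h | h := hS.oddComp_cases hm hmo hmf hgf hpar hK
    · exact .inl ⟨hK, h⟩
    · exact .inr (.inl ⟨hK, h⟩)
    · exact .inr (.inr (.inl ⟨hK, h⟩))
    · exact .inr (.inr (.inr ⟨hK, h⟩))
  have e₁ : O₁.ncard ≤ {c : Σ v, Fin (m v) | c.1 ∈ A}.ncard :=
    ncard_le_of_rel _ (fun K (c : Σ v, Fin (m v)) => Node.core c ∈ K) (fun K hK => hK.2)
      fun K hK L hL _ _ h h' => hK.1.1.eq_of_mem hL.1.1 h h'
  have e₂ : O₂.ncard ≤ pairCount G.Adj B A := by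
    refine ncard_le_of_rel _ (fun K p => ∃ h : G.Adj p.1 p.2, .dart ⟨p, h⟩ ∈ K) ?_ ?_
    · rintro K ⟨-, v, w, h, hv, hw, hmem⟩
      exact ⟨(v, w), ⟨hv, hw, h⟩, h, hmem⟩
    · rintro K hK L hL p - ⟨h, hp⟩ ⟨h', hp'⟩
      exact hK.1.1.eq_of_mem hL.1.1 hp hp'
  have e₃ : O₃.ncard ≤ H.ncard := by
    refine ncard_le_of_rel _ (fun K c => ∃ v ∈ compSupp c, ∃ x ∈ block G m o k v, x ∈ K)
      (fun K hK => hK.2) ?_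
    rintro K hK L hL c - ⟨v, hv, x, hx, hxK⟩ ⟨w, hw, y, hy, hyL⟩
    have hK' := hS.block_subset_of_mem hm (isCompSet_compSupp c) hK.1.1.2.1 hv hxK hx w hw
    exact hK.1.1.eq_of_mem hL.1.1 (hK' hy) hyL
  have e₄ : O₄.ncard ≤ 1 := by
    rw [Set.ncard_le_one]
    exact fun K hK L hL => hK.1.1.eq_of_mem hL.1.1 hK.2 hL.2
  have hHn : H.ncard = hWnum G W g f A B := (Nat.card_coe_set_eq H).symm
  have h0 := Set.ncard_le_ncard hcover
  have h1 := Set.ncard_union_le O₁ (O₂ ∪ (O₃ ∪ O₄))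
  have h2 := Set.ncard_union_le O₂ (O₃ ∪ O₄)
  have h3 := Set.ncard_union_le O₃ O₄
  rw [← ncard_sigma_fin]
  omega

/-- A tight barrier of the auxiliary graph gives a pair of sets with negative `deltaG`. -/
lemma IsTight.deltaG_neg (hS : IsTight (gadget G W m o k) S)
    (hbar : S.ncard + 2 ≤ (oddCompSets (gadget G W m o k) S).ncard)
    (hm : ∀ v, 0 < m v → ∃ w, G.Adj v w)
    (hmo : ∀ v, (m v + o v : ℤ) = (G.neighborSet v).ncard - g v)
    (hmf : ∀ v, (m v : ℤ) = max ((G.neighborSet v).ncard - f v) 0)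
    (hgf : ∀ v, g v ≤ f v) (hpar : ∀ v ∈ W, g v ≡ f v [ZMOD 2]) :
    deltaG G W g f (dartSide S) (hubSide S) < 0 := by
  have h1 := hS.le_ncard
  have h2 := hS.ncard_oddCompSets_le hm hmo hmf hgf hpar
  set A := dartSide S
  set B := hubSide S
  have e1 : ∑ᶠ v ∈ A, (m v : ℤ) = pairCount G.Adj A Set.univ - ∑ᶠ v ∈ A, f v := by
    rw [← finsum_degree, ← finsum_mem_sub_distrib _ _ (Set.toFinite _)]
    refine finsum_mem_congr rfl ?_
    rintro v ⟨w, h, hmem⟩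
    have := hS.pos_of_dart_mem h hmem
    have := hmf v
    omega
  have e2 : ∑ᶠ v ∈ B, ((m v : ℤ) + o v) = pairCount G.Adj B Set.univ - ∑ᶠ v ∈ B, g v := by
    rw [← finsum_degree, ← finsum_mem_sub_distrib _ _ (Set.toFinite _)]
    exact finsum_mem_congr rfl fun v _ => hmo v
  have e3 : pairCount G.Adj B Set.univ = pairCount G.Adj B A + pairCount G.Adj B Aᶜ :=
    pairCount_eq_add (fun x hx y => by grind) (fun x hx y hy _ hy' _ => hy' hy)
  rw [deltaG, finsum_degDel]
  omega

end BarrierCount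

section Matching

variable {V : Type*} [Fintype V] {G : SimpleGraph V} {W : Set V} {m o : V → ℕ} {k : ℕ}
  {g f : V → ℤ}

/-- A perfect matching of the auxiliary graph yields a partial parity factor. -/
lemma exists_isPPFactor_of_isPerfectMatching {M : (gadget G W m o k).Subgraph}
    (hM : M.IsPerfectMatching)
    (hmo : ∀ v, (m v + o v : ℤ) = (G.neighborSet v).ncard - g v)
    (hmf : ∀ v, (m v : ℤ) = max ((G.neighborSet v).ncard - f v) 0)
    (hpar : ∀ v ∈ W, g v ≡ f v [ZMOD 2]) :
    ∃ F : SimpleGraph V, IsPPFactor G F W g f := by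
  rw [Subgraph.isPerfectMatching_iff] at hM
  choose μ hμ hμu using hM
  simp only at hμ hμu
  have hμμ : ∀ x, μ (μ x) = x := fun x => (hμu _ _ (hμ x).symm).symm
  have hadj : ∀ x, (gadget G W m o k).Adj x (μ x) := fun x => (hμ x).adj_sub
  have hinj : Function.Injective μ := fun x y h => by rw [← hμμ x, h, hμμ]
  let F : SimpleGraph V :=
    { Adj := fun v w => ∃ h : G.Adj v w, μ (.mkDart h) = .mkDart h.symm
      symm := ⟨fun v w ⟨h, e⟩ => ⟨h.symm, by rw [← e, hμμ]⟩⟩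
      loopless := ⟨fun v ⟨h, _⟩ => h.ne rfl⟩ }
  have key : ∀ v, ∃ r : ℕ, r ≤ o v ∧ (v ∈ W → Even r) ∧
      ((F.neighborSet v).ncard : ℤ) = g v + r := by
    intro v
    set X : Set (Node G m o k) := {x | ∃ w, ∃ h : G.Adj v w, x = .mkDart h}
    set Y : Set (Node G m o k) := {x ∈ X | ∃ d, μ x = .dart d} with hY
    set Z : Set (Node G m o k) := {x ∈ X | ¬ ∃ d, μ x = .dart d} with hZ
    set C : Set (Node G m o k) := {x | ∃ i, x = .core ⟨v, i⟩} with hC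
    set O : Set (Node G m o k) := {x | ∃ i, x = .opt ⟨v, i⟩} with hO
    set O₁ : Set (Node G m o k) := {x ∈ O | ∃ d, μ x = .dart d} with hO₁
    set O₂ : Set (Node G m o k) := {x ∈ O | ¬ ∃ d, μ x = .dart d} with hO₂
    have cX : X.ncard = (G.neighborSet v).ncard := by
      symm
      refine Set.ncard_congr (fun w hw => Node.mkDart hw) ?_ ?_ ?_
      · exact fun w hw => ⟨w, hw, rfl⟩
      · intro a b _ _ h
        cases h
        rfl
      · rintro _ ⟨w, h, rfl⟩
        exact ⟨w, h, rfl⟩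
    have cY : Y.ncard = (F.neighborSet v).ncard := by
      symm
      refine Set.ncard_congr (fun w hw => Node.mkDart hw.1) ?_ ?_ ?_
      · exact fun w hw => ⟨⟨w, hw.1, rfl⟩, _, hw.2⟩
      · intro a b _ _ h
        cases h
        rfl
      · rintro _ ⟨⟨w, h, rfl⟩, ⟨p, hp⟩, hd⟩
        refine ⟨w, ⟨h, ?_⟩, rfl⟩
        have := hadj (.mkDart h)
        rw [hd] at this ⊢
        obtain rfl : p = (w, v) := this
        rfl
    have cC : C.ncard = m v := by
      have : C = Set.range fun i => Node.core ⟨v, i⟩ := by ext; simp [hC, eq_comm]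
      rw [this, Set.ncard_range_of_injective (fun a b h => by simpa using h), Nat.card_fin]
    have cO : O.ncard = o v := by
      have : O = Set.range fun i => Node.opt ⟨v, i⟩ := by ext; simp [hO, eq_comm]
      rw [this, Set.ncard_range_of_injective (fun a b h => by simpa using h), Nat.card_fin]
    have sX : Y.ncard + Z.ncard = X.ncard := by
      rw [← Set.ncard_union_eq (Set.disjoint_left.2 fun x hx hx' => hx'.2 hx.2)]
      congr 1
      ext x
      simp only [hY, hZ, Set.mem_union, Set.mem_ofPred_eq]
      tauto
    have sO : O₁.ncard + O₂.ncard = O.ncard := by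
      rw [← Set.ncard_union_eq (Set.disjoint_left.2 fun x hx hx' => hx'.2 hx.2)]
      congr 1
      ext x
      simp only [hO₁, hO₂, Set.mem_union, Set.mem_ofPred_eq]
      tauto
    have hZim : μ '' Z = C ∪ O₁ := by
      ext y
      constructor
      · rintro ⟨_, ⟨⟨w, h, rfl⟩, hnd⟩, rfl⟩
        have := hadj (.mkDart h)
        have hback := hμμ (.mkDart h)
        rcases hy : μ (.mkDart h) with (d | ⟨u, i⟩ | ⟨u, i⟩ | i) <;> rw [hy] at this hback
        · exact absurd ⟨d, hy⟩ hnd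
        · obtain rfl : v = u := this
          exact .inl ⟨i, rfl⟩
        · obtain rfl : v = u := this
          exact .inr ⟨⟨i, rfl⟩, _, hback⟩
        · exact this.elim
      · have aux : ∀ x ∈ hubs G m o k v, (∃ d, μ x = .dart d) → x ∈ μ '' Z := by
          rintro x hx ⟨⟨⟨u, w⟩, h⟩, hd⟩
          have := hadj x
          rw [hd, adj_hub_dart_iff hx] at this
          obtain rfl : u = v := this
          have hback : μ (.mkDart h) = x := by
            rw [← hμμ x, hd]
          refine ⟨_, ⟨⟨w, h, rfl⟩, ?_⟩, hback⟩
          rw [hback]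
          rintro ⟨d, rfl⟩
          obtain ⟨i, hi⟩ | ⟨i, hi⟩ := hx <;> cases hi
        rintro (⟨i, rfl⟩ | ⟨⟨i, rfl⟩, hd⟩)
        · exact aux _ (.inl ⟨i, rfl⟩) (core_adj (hadj _))
        · exact aux _ (.inr ⟨i, rfl⟩) hd
    have cZ : Z.ncard = C.ncard + O₁.ncard := by
      rw [← Set.ncard_image_of_injective Z hinj, hZim, Set.ncard_union_eq]
      rw [Set.disjoint_left]
      rintro _ ⟨i, rfl⟩ ⟨⟨j, hj⟩, -⟩
      cases hj
    refine ⟨O₂.ncard, by omega, fun hvW => ?_, ?_⟩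
    · refine even_ncard_of_involution _ μ ?_ (fun x _ => hμμ x) (fun x _ h => ?_)
      · rintro _ ⟨⟨i, rfl⟩, hnd⟩
        have := hadj (.opt ⟨v, i⟩)
        have hback := hμμ (.opt ⟨v, i⟩)
        rcases hy : μ (.opt ⟨v, i⟩) with (d | ⟨u, j⟩ | ⟨u, j⟩ | j) <;> rw [hy] at this hback
        · exact absurd ⟨d, hy⟩ hnd
        · exact this.elim
        · obtain rfl : v = u := this.2.resolve_right fun h => h.1 hvW
          refine ⟨⟨j, rfl⟩, ?_⟩
          rw [hback]
          rintro ⟨d, hd⟩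
          cases hd
        · exact absurd hvW this
      · exact (hadj x).ne h.symm
    · have := hmo v
      omega
  refine ⟨F, fun v w h => h.1, fun v => ?_, fun v hv => ?_⟩
  · obtain ⟨r, hr, -, he⟩ := key v
    have := hmo v
    have := hmf v
    omega
  · obtain ⟨r, -, hr, he⟩ := key v
    obtain ⟨t, ht⟩ := hr hv
    have := hpar v hv
    unfold Int.ModEq at this ⊢
    omega

end Matching

end PartialParityFactor

/-- Kano–Matsuda: `G` has a partial parity `(g,f)`-factor with respect to `W`
iff `δ_G(A,B) ≥ 0` for all disjoint `A, B ⊆ V(G)`. -/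
theorem partial_parity_factor_iff {V : Type*} [Fintype V] (G : SimpleGraph V) (W : Set V)
    (g f : V → ℤ) (hgf : ∀ v : V, g v ≤ f v)
    (hpar : ∀ v ∈ W, Int.ModEq 2 (g v) (f v)) :
    (∃ F : SimpleGraph V, IsPPFactor G F W g f) ↔
      ∀ A B : Set V, Disjoint A B → 0 ≤ deltaG G W g f A B := by
  refine ⟨fun ⟨F, hF⟩ A B hAB => PartialParityFactor.deltaG_nonneg_of_isPPFactor hF hAB,
    fun hδ => ?_⟩
  have hf : ∀ v, 0 ≤ f v := by
    intro v
    have := hδ {v} ∅ (Set.disjoint_empty _)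
    simp only [deltaG, finsum_mem_singleton, finsum_mem_empty] at this
    omega
  have hg : ∀ v, g v ≤ (G.neighborSet v).ncard := by
    intro v
    have := hδ ∅ {v} (Set.empty_disjoint _)
    simp only [deltaG, finsum_mem_singleton, finsum_mem_empty, degDel, Set.sdiff_empty] at this
    omega
  obtain ⟨m, hm⟩ : ∃ m : V → ℕ, ∀ v, (m v : ℤ) = max ((G.neighborSet v).ncard - f v) 0 :=
    ⟨fun v => ((G.neighborSet v).ncard - f v).toNat, fun v => Int.toNat_eq_max _⟩
  obtain ⟨o, ho⟩ : ∃ o : V → ℕ, ∀ v, (m v + o v : ℤ) = (G.neighborSet v).ncard - g v := by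
    refine ⟨fun v => ((G.neighborSet v).ncard - g v - m v).toNat, fun v => ?_⟩
    have := hm v
    have := hgf v
    have := hg v
    beta_reduce
    omega
  obtain ⟨k, hk⟩ := PartialParityFactor.exists_even_card_node (G := G) (m := m) (o := o)
  by_cases hM : ∃ M : (PartialParityFactor.gadget G W m o k).Subgraph, M.IsPerfectMatching
  · obtain ⟨M, hM⟩ := hM
    exact PartialParityFactor.exists_isPPFactor_of_isPerfectMatching hM ho hm hpar
  · obtain ⟨S, hbar, hS⟩ := PartialParityFactor.exists_minimal_barrier hk hM
    have hdeg : ∀ v, 0 < m v → ∃ w, G.Adj v w := by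
      intro v hv
      have h1 := hm v
      have h2 := hf v
      exact Set.nonempty_of_ncard_ne_zero (s := G.neighborSet v) (by omega)
    have := hS.deltaG_neg hbar hdeg ho hm hgf hpar
    exact absurd (hδ _ _ (PartialParityFactor.disjoint_dartSide_hubSide (S := S))) (not_le.2 this)
end
end

section
/- Let G[X,Y] be a finite bipartite graph and k ≥ 1 an integer, let W = X, and let f, g : V(G) → ℤ be defined by f(v) = 2 for v ∈ X, f(v) = k for v ∈ Y, g(v) = 0 for v ∈ X, g(v) = k for v ∈ Y. If k·|Y| is even, then δ_G(A,B) ≡ 0 (mod 2) for all disjoint subsets A, B ⊆ V(G). -/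
noncomputable section

/-- The function `f` of the `(2,k)`-factor setting: `f = 2` on `X` and `f = k` on `Y`. -/
def fB (X Y : Type*) (k : ℕ) : X ⊕ Y → ℤ := Sum.elim (fun _ => 2) (fun _ => (k : ℤ))

/-- The function `g` of the `(2,k)`-factor setting: `g = 0` on `X` and `g = k` on `Y`. -/
def gB (X Y : Type*) (k : ℕ) : X ⊕ Y → ℤ := Sum.elim (fun _ => 0) (fun _ => (k : ℤ))

open Classical in
/-- The parity of the number of neighbours of `v` in `S`. -/
def nbrParity {V : Type*} [Fintype V] (G : SimpleGraph V) (S : Set V) (v : V) : ZMod 2 :=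
  ∑ w, if w ∈ S ∧ G.Adj v w then 1 else 0

open Classical in
theorem cast_finsum_mem {V : Type*} [Fintype V] (S : Set V) (F : V → ℤ) :
    ((∑ᶠ v ∈ S, F v : ℤ) : ZMod 2) = ∑ v, if v ∈ S then (F v : ZMod 2) else 0 := by
  rw [finsum_mem_def, finsum_eq_sum_of_fintype, Int.cast_sum]
  refine Finset.sum_congr rfl fun v _ => ?_
  by_cases h : v ∈ S <;> simp [h]

open Classical in
theorem cast_eCnt {V : Type*} [Fintype V] (G : SimpleGraph V) (S T : Set V) :
    (eCnt G S T : ZMod 2) = ∑ v, if v ∈ S then nbrParity G T v else 0 := by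
  have h : ∀ v, (if v ∈ S then nbrParity G T v else 0) =
      ∑ w, if v ∈ S ∧ w ∈ T ∧ G.Adj v w then (1 : ZMod 2) else 0 := by
    intro v
    by_cases hv : v ∈ S <;> simp [hv, nbrParity]
  simp only [h]
  rw [← Fintype.sum_prod_type'
    (f := fun v w => if v ∈ S ∧ w ∈ T ∧ G.Adj v w then (1 : ZMod 2) else 0),
    Finset.sum_boole, eCnt, Nat.card_eq_fintype_card, Fintype.card_subtype]

/-- Deleting `A` from a graph leaves, for a vertex, the neighbours in `B` and those outside
`A ∪ B`. -/
theorem cast_degDel {V : Type*} [Fintype V] (G : SimpleGraph V) {A B : Set V}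
    (hAB : Disjoint A B) (v : V) :
    (degDel G A v : ZMod 2) = nbrParity G B v + nbrParity G (A ∪ B)ᶜ v := by
  classical
  have h : G.neighborSet v \ A =
      ((Finset.univ.filter fun w => w ∉ A ∧ G.Adj v w : Finset V) : Set V) := by
    ext w
    simp [and_comm]
  rw [degDel, h, Set.ncard_coe_finset, ← Finset.sum_boole, nbrParity, nbrParity,
    ← Finset.sum_add_distrib]
  refine Finset.sum_congr rfl fun w _ => ?_
  have hw : w ∈ A → w ∉ B := fun h => Set.disjoint_left.1 hAB h
  by_cases h₁ : w ∈ A <;> by_cases h₂ : w ∈ B <;> by_cases h₃ : G.Adj v w <;> simp_all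

theorem sum_nbrParity_comm {V : Type*} [Fintype V] (G : SimpleGraph V) (S T : Set V)
    [DecidablePred (· ∈ S)] [DecidablePred (· ∈ T)] :
    (∑ v, if v ∈ S then nbrParity G T v else 0) =
      ∑ v, if v ∈ T then nbrParity G S v else 0 := by
  classical
  have h : ∀ (P Q : Set V) [DecidablePred (· ∈ P)] v, (if v ∈ P then nbrParity G Q v else 0) =
      ∑ w, if v ∈ P ∧ w ∈ Q ∧ G.Adj v w then (1 : ZMod 2) else 0 := by
    intro P Q _ v
    by_cases hv : v ∈ P <;> simp [hv, nbrParity]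
  simp only [h]
  rw [Finset.sum_comm]
  refine Finset.sum_congr rfl fun v _ => Finset.sum_congr rfl fun w _ => ?_
  simp only [G.adj_comm w v, and_left_comm]

open Classical in
/-- The handshake lemma modulo two, for the subgraph induced by `S`. -/
theorem sum_nbrParity_self {V : Type*} [Fintype V] (G : SimpleGraph V) (S : Set V) :
    (∑ v, if v ∈ S then nbrParity G S v else 0) = 0 := by
  have h : ∀ v, (if v ∈ S then nbrParity G S v else 0) =
      ∑ w, if v ∈ S ∧ w ∈ S ∧ G.Adj v w then (1 : ZMod 2) else 0 := by
    intro v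
    by_cases hv : v ∈ S <;> simp [hv, nbrParity]
  simp only [h]
  rw [← Fintype.sum_prod_type'
    (f := fun v w => if v ∈ S ∧ w ∈ S ∧ G.Adj v w then (1 : ZMod 2) else 0)]
  refine Finset.sum_involution (fun p _ => p.swap) ?_ ?_ (fun _ _ => Finset.mem_univ _)
    (fun _ _ => Prod.swap_swap _)
  · rintro ⟨v, w⟩ -
    simp only [Prod.fst_swap, Prod.snd_swap, G.adj_comm w v, and_left_comm (a := w ∈ S)]
    exact CharTwo.add_self_eq_zero _
  · rintro ⟨v, w⟩ - hne heq
    have hvw : w = v := congrArg Prod.fst heq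
    simp [hvw] at hne

open Classical in
/-- Summing over the components of an induced subgraph amounts to summing over its vertices. -/
theorem sum_compSupp {V M : Type*} [Fintype V] [AddCommMonoid M] (G : SimpleGraph V) (s : Set V)
    [DecidablePred (· ∈ s)] [Fintype (G.induce s).ConnectedComponent] (F : V → M) :
    (∑ c : (G.induce s).ConnectedComponent, ∑ v, if v ∈ compSupp c then F v else 0) =
      ∑ v, if v ∈ s then F v else 0 := by
  rw [Finset.sum_comm]
  refine Finset.sum_congr rfl fun v _ => ?_
  by_cases hv : v ∈ s
  · have h : ∀ c : (G.induce s).ConnectedComponent,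
        v ∈ compSupp c ↔ (G.induce s).connectedComponentMk ⟨v, hv⟩ = c := by
      intro c
      simp [compSupp, hv]
    simp [h, hv]
  · have h : ∀ c : (G.induce s).ConnectedComponent, v ∉ compSupp c := by
      rintro c ⟨u, -, rfl⟩
      exact hv u.2
    simp [h, hv]

open Classical in
theorem cast_hWnum {V : Type*} [Fintype V] (G : SimpleGraph V) (W : Set V) (g f : V → ℤ)
    (hW : ∀ v, v ∉ W → g v = f v) (A B : Set V) :
    (hWnum G W g f A B : ZMod 2) =
      ∑ v, if v ∈ (A ∪ B)ᶜ then (f v : ZMod 2) + nbrParity G B v else 0 := by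
  have := Fintype.ofFinite (G.induce (A ∪ B)ᶜ).ConnectedComponent
  rw [hWnum, Nat.card_eq_fintype_card, Fintype.card_subtype, ← Finset.sum_boole, ← sum_compSupp G]
  refine Finset.sum_congr rfl fun c _ => ?_
  have hc : (((∑ᶠ v ∈ compSupp c, f v) + (eCnt G (compSupp c) B : ℤ) : ℤ) : ZMod 2) =
      ∑ v, if v ∈ compSupp c then (f v : ZMod 2) + nbrParity G B v else 0 := by
    rw [Int.cast_add, cast_finsum_mem, Int.cast_natCast, cast_eCnt, ← Finset.sum_add_distrib]
    refine Finset.sum_congr rfl fun v _ => ?_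
    split_ifs <;> simp
  rw [← hc]
  split_ifs with h
  · exact ((ZMod.intCast_eq_one_iff_odd).2 h.2).symm
  · have h' : ¬ IsOddComp G f A B c := fun ho => h ⟨fun v hv => hW v hv.2, ho⟩
    exact ((ZMod.intCast_eq_zero_iff_even).2 (Int.not_odd_iff_even.1 h')).symm

/-- If `g ≡ f (mod 2)`, and `g = f` off `W`, then `δ_G(A,B)` has the parity of `Σ f`. -/
theorem deltaG_cast_eq_sum {V : Type*} [Fintype V] (G : SimpleGraph V) (W : Set V) (g f : V → ℤ)
    (hgf : ∀ v, (g v : ZMod 2) = f v) (hW : ∀ v, v ∉ W → g v = f v) (A B : Set V)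
    (hAB : Disjoint A B) :
    (deltaG G W g f A B : ZMod 2) = ∑ v, (f v : ZMod 2) := by
  classical
  have hdeg : (∑ v, if v ∈ B then (((degDel G A v : ℕ) : ℤ) : ZMod 2) else 0) =
      ∑ v, if v ∈ (A ∪ B)ᶜ then nbrParity G B v else 0 := by
    rw [sum_nbrParity_comm, ← zero_add (∑ v, _), ← sum_nbrParity_self G B,
      ← Finset.sum_add_distrib]
    refine Finset.sum_congr rfl fun v _ => ?_
    rw [Int.cast_natCast, cast_degDel G hAB]
    split_ifs <;> simp [← add_assoc, CharTwo.add_self_eq_zero]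
  rw [deltaG, Int.cast_sub, Int.cast_add, Int.cast_sub, cast_finsum_mem, cast_finsum_mem,
    cast_finsum_mem, hdeg, Int.cast_natCast, cast_hWnum G W g f hW]
  simp only [CharTwo.sub_eq_add, ← Finset.sum_add_distrib, hgf]
  refine Finset.sum_congr rfl fun v _ => ?_
  have hv : v ∈ A → v ∉ B := fun h => Set.disjoint_left.1 hAB h
  have htwo := CharTwo.add_self_eq_zero (nbrParity G B v)
  by_cases h₁ : v ∈ A <;> by_cases h₂ : v ∈ B <;> simp_all
  linear_combination htwo

/-- with `W = X` and `f, g` as in the `(2,k)`-factor setting, if `k·|Y|` is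
even then `δ_G(A,B) ≡ 0 (mod 2)` for all disjoint `A, B`. -/
theorem deltaG_even {X Y : Type*} [Fintype X] [Fintype Y] (G : SimpleGraph (X ⊕ Y))
    (hX : ∀ x x' : X, ¬ G.Adj (Sum.inl x) (Sum.inl x'))
    (hY : ∀ y y' : Y, ¬ G.Adj (Sum.inr y) (Sum.inr y'))
    (k : ℕ) (hk : 1 ≤ k) (heven : Even (k * Fintype.card Y))
    (A B : Set (X ⊕ Y)) (hAB : Disjoint A B) :
    Int.ModEq 2 (deltaG G (Set.range (Sum.inl : X → X ⊕ Y)) (gB X Y k) (fB X Y k) A B) 0 := by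
  have hgf : ∀ v, ((gB X Y k v : ℤ) : ZMod 2) = (fB X Y k v : ℤ) := by
    rintro (x | y)
    · exact (ZMod.intCast_eq_intCast_iff_dvd_sub 0 2 2).2 (by norm_num)
    · rfl
  have hW : ∀ v, v ∉ Set.range (Sum.inl : X → X ⊕ Y) → gB X Y k v = fB X Y k v := by
    rintro (x | y) h
    · exact absurd ⟨x, rfl⟩ h
    · rfl
  have hsum : Even (∑ v, fB X Y k v) := by
    obtain ⟨m, hm⟩ := heven
    refine ⟨Fintype.card X + m, ?_⟩
    have hm' : (k : ℤ) * Fintype.card Y = m + m := by exact_mod_cast hm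
    simp only [fB, Fintype.sum_sum_type, Sum.elim_inl, Sum.elim_inr, Finset.sum_const,
      Finset.card_univ, nsmul_eq_mul]
    linarith
  refine (ZMod.intCast_eq_intCast_iff _ _ 2).1 ?_
  rw [deltaG_cast_eq_sum G _ _ _ hgf hW A B hAB, ← Int.cast_sum, Int.cast_zero]
  exact (ZMod.intCast_zmod_eq_zero_iff_dvd _ 2).2 hsum.two_dvd
end
end

section
/- Let G[X,Y] be a finite bipartite graph and k ≥ 1 an integer with k·|Y| even; suppose G has no partial parity (g,f)-factor with respect to W = X, where f(v) = 2 for v ∈ X, f(v) = k for v ∈ Y, g(v) = 0 for v ∈ X, g(v) = k for v ∈ Y. If (A,B) is a biased barrier of G, then B ⊆ Y. -/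
noncomputable section

/-- `(A,B)` is a barrier: a pair of disjoint vertex sets with `δ_G(A,B) < 0`. -/
def IsBarrier {V : Type*} (G : SimpleGraph V) (W : Set V) (g f : V → ℤ) (A B : Set V) : Prop :=
  Disjoint A B ∧ deltaG G W g f A B < 0

/-- `(A,B)` is a biased barrier: among all barriers, `δ_G(A,B)` is minimum; subject to that,
`|B|` is minimum; subject to that, `|A|` is maximum. -/
def IsBiasedBarrier {V : Type*} (G : SimpleGraph V) (W : Set V) (g f : V → ℤ)
    (A B : Set V) : Prop :=
  IsBarrier G W g f A B ∧
  (∀ A' B' : Set V, IsBarrier G W g f A' B' → deltaG G W g f A B ≤ deltaG G W g f A' B') ∧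
  (∀ A' B' : Set V, IsBarrier G W g f A' B' →
    deltaG G W g f A' B' = deltaG G W g f A B → B.ncard ≤ B'.ncard) ∧
  (∀ A' B' : Set V, IsBarrier G W g f A' B' →
    deltaG G W g f A' B' = deltaG G W g f A B → B'.ncard = B.ncard → A'.ncard ≤ A.ncard)

theorem compSupp_injective {V : Type*} {G : SimpleGraph V} {s : Set V} :
    Function.Injective (compSupp : (G.induce s).ConnectedComponent → Set V) := fun _ _ h =>
  SimpleGraph.ConnectedComponent.supp_injective
    (Function.Injective.image_injective Subtype.val_injective h)

theorem eq_of_mem_compSupp {V : Type*} {G : SimpleGraph V} {s : Set V}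
    {c c' : (G.induce s).ConnectedComponent} {v : V} (h : v ∈ compSupp c) (h' : v ∈ compSupp c') :
    c = c' := by
  obtain ⟨a, ha, rfl⟩ := h
  obtain ⟨b, hb, hab⟩ := h'
  obtain rfl := Subtype.val_injective hab
  exact ha.symm.trans hb

/-- A component of `G[s]` with no edge to `t \ s` is also a component of `G[t]`. -/
theorem exists_compSupp_eq_of_forall_not_adj {V : Type*} {G : SimpleGraph V} {s t : Set V}
    (hst : s ⊆ t) (c : (G.induce s).ConnectedComponent)
    (hc : ∀ v ∈ compSupp c, ∀ w ∈ t, w ∉ s → ¬ G.Adj v w) :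
    ∃ c' : (G.induce t).ConnectedComponent, compSupp c' = compSupp c := by
  obtain ⟨a, rfl⟩ := c.exists_rep
  refine ⟨(G.induce t).connectedComponentMk ⟨a.1, hst a.2⟩, Set.Subset.antisymm ?_ ?_⟩
  · have closed : ∀ u w : t, (G.induce t).Walk u w →
        u.1 ∈ compSupp ((G.induce s).connectedComponentMk a) →
        w.1 ∈ compSupp ((G.induce s).connectedComponentMk a) := by
      intro u w p
      induction p with
      | nil => exact id
      | @cons u v w huv _ ih =>
        intro hu
        apply ih
        have hadj : G.Adj u.1 v.1 := huv
        have hvs : v.1 ∈ s := by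
          by_contra hv
          exact hc _ hu _ v.2 hv hadj
        obtain ⟨b, hb, hbu⟩ := hu
        refine ⟨⟨v.1, hvs⟩, ?_, rfl⟩
        have hbv : (G.induce s).Adj b ⟨v.1, hvs⟩ := by
          change G.Adj b.1 v.1
          rwa [hbu]
        rw [SimpleGraph.ConnectedComponent.mem_supp_iff] at hb ⊢
        rw [← hb]
        exact (SimpleGraph.ConnectedComponent.sound hbv.reachable).symm
    rintro _ ⟨w, hw, rfl⟩
    obtain ⟨p⟩ := (SimpleGraph.ConnectedComponent.exact hw).symm
    exact closed _ _ p ⟨a, rfl, rfl⟩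
  · rintro _ ⟨w, hw, rfl⟩
    refine ⟨⟨w.1, hst w.2⟩, ?_, rfl⟩
    have hr : (G.induce s).Reachable w a := SimpleGraph.ConnectedComponent.exact hw
    exact SimpleGraph.ConnectedComponent.sound (hr.map (SimpleGraph.induceHomOfLE G hst).toHom)

theorem eCnt_sdiff_singleton {V : Type*} (G : SimpleGraph V) {S B : Set V} {x : V}
    (h : ∀ v ∈ S, ¬ G.Adj v x) : eCnt G S (B \ {x}) = eCnt G S B := by
  refine Nat.card_congr (Equiv.subtypeEquivRight fun p => ?_)
  constructor
  · rintro ⟨h1, h2, h3⟩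
    exact ⟨h1, h2.1, h3⟩
  · rintro ⟨h1, h2, h3⟩
    refine ⟨h1, ⟨h2, fun hx => h _ h1 ?_⟩, h3⟩
    rwa [← Set.mem_singleton_iff.mp hx]

/-- Removing `x` from `B` destroys at most one odd component for each neighbour of `x` outside
`A`. -/
theorem hWnum_le_hWnum_sdiff_singleton_add_degDel {V : Type*} [Finite V] (G : SimpleGraph V)
    (W : Set V) (g f : V → ℤ) (A B : Set V) (x : V) :
    hWnum G W g f A B ≤ hWnum G W g f A (B \ {x}) + degDel G A x := by
  have hst : (A ∪ B)ᶜ ⊆ (A ∪ B \ {x})ᶜ :=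
    Set.compl_subset_compl.mpr (Set.union_subset_union_right A Set.sdiff_subset)
  have key : ∀ c : {c : (G.induce (A ∪ B)ᶜ).ConnectedComponent //
        (∀ v ∈ compSupp c \ W, g v = f v) ∧ IsOddComp G f A B c},
      ∃ r : {c : (G.induce (A ∪ B \ {x})ᶜ).ConnectedComponent //
        (∀ v ∈ compSupp c \ W, g v = f v) ∧ IsOddComp G f A (B \ {x}) c} ⊕
          (G.neighborSet x \ A : Set V),
        (∀ c', r = Sum.inl c' → compSupp c'.1 = compSupp c.1) ∧
          ∀ v, r = Sum.inr v → v.1 ∈ compSupp c.1 := by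
    rintro ⟨c, hg, hodd⟩
    by_cases h : ∃ v ∈ compSupp c, G.Adj v x
    · obtain ⟨v, hv, hvx⟩ := h
      have hvA : v ∉ A := by
        obtain ⟨w, -, rfl⟩ := hv
        exact fun hA => w.2 (Or.inl hA)
      refine ⟨Sum.inr ⟨v, hvx.symm, hvA⟩, nofun, fun w h => ?_⟩
      cases h
      exact hv
    · push Not at h
      obtain ⟨c', hc'⟩ := exists_compSupp_eq_of_forall_not_adj hst c (by
        intro v hv w hwt hws hvw
        obtain rfl : w = x := by
          by_contra hwx
          exact hws fun hw => hwt (hw.imp_right fun hB => ⟨hB, hwx⟩)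
        exact h v hv hvw)
      refine ⟨Sum.inl ⟨c', ?_, ?_⟩, fun d h => ?_, nofun⟩
      · rwa [hc']
      · unfold IsOddComp at hodd ⊢
        rwa [hc', eCnt_sdiff_singleton G h]
      · cases h
        exact hc'
  choose r hr₁ hr₂ using key
  have hinj : Function.Injective r := by
    intro c d hcd
    apply Subtype.ext
    cases hc : r c with
    | inl c' =>
      exact compSupp_injective ((hr₁ c c' hc).symm.trans (hr₁ d c' (hcd.symm.trans hc)))
    | inr v => exact eq_of_mem_compSupp (hr₂ c v hc) (hr₂ d v (hcd.symm.trans hc))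
  have hcard := Nat.card_le_card_of_injective r hinj
  rwa [Nat.card_sum] at hcard

theorem deltaG_sdiff_singleton_le {V : Type*} [Finite V] (G : SimpleGraph V)
    (W : Set V) (g f : V → ℤ) (A B : Set V) {x : V} (hx : x ∈ B) (hgx : g x ≤ 0) :
    deltaG G W g f A (B \ {x}) ≤ deltaG G W g f A B := by
  have hsum : ∀ φ : V → ℤ, ∑ᶠ v ∈ B, φ v = φ x + ∑ᶠ v ∈ B \ {x}, φ v := fun φ => by
    rw [← finsum_mem_insert φ (fun h : x ∈ B \ {x} => h.2 rfl) (Set.toFinite _),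
      Set.insert_sdiff_singleton, Set.insert_eq_of_mem hx]
  have hle := hWnum_le_hWnum_sdiff_singleton_add_degDel G W g f A B x
  unfold deltaG
  rw [hsum g, hsum fun v => (degDel G A v : ℤ)]
  omega

/-- for a biased barrier `(A,B)`, we have `B ⊆ Y`. -/
theorem biased_barrier_B_subset_Y {X Y : Type*} [Fintype X] [Fintype Y]
    (G : SimpleGraph (X ⊕ Y))
    (hX : ∀ x x' : X, ¬ G.Adj (Sum.inl x) (Sum.inl x'))
    (hY : ∀ y y' : Y, ¬ G.Adj (Sum.inr y) (Sum.inr y'))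
    (k : ℕ) (hk : 1 ≤ k) (heven : Even (k * Fintype.card Y))
    (hno : ¬ ∃ F : SimpleGraph (X ⊕ Y),
      IsPPFactor G F (Set.range (Sum.inl : X → X ⊕ Y)) (gB X Y k) (fB X Y k))
    (A B : Set (X ⊕ Y))
    (hAB : IsBiasedBarrier G (Set.range (Sum.inl : X → X ⊕ Y)) (gB X Y k) (fB X Y k) A B)
 :
    B ⊆ Set.range (Sum.inr : Y → X ⊕ Y) := by
  rintro (x | y) hv
  · obtain ⟨⟨hdisj, hneg⟩, hmin, hB, -⟩ := hAB
    have hle := deltaG_sdiff_singleton_le G (Set.range (Sum.inl : X → X ⊕ Y)) (gB X Y k)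
      (fB X Y k) A B hv le_rfl
    have hbar : IsBarrier G (Set.range (Sum.inl : X → X ⊕ Y)) (gB X Y k) (fB X Y k) A
        (B \ {Sum.inl x}) := ⟨hdisj.mono_right Set.sdiff_subset, hle.trans_lt hneg⟩
    have hcard := hB _ _ hbar (le_antisymm hle (hmin _ _ hbar))
    exact absurd (Set.ncard_sdiff_singleton_lt_of_mem hv) hcard.not_gt
  · exact ⟨y, rfl⟩
end
end

section
/- Let G[X,Y] be a finite bipartite graph and k ≥ 1 an integer with k·|Y| even; suppose G has no partial parity (g,f)-factor with respect to W = X, where f(v) = 2 for v ∈ X, f(v) = k for v ∈ Y, g(v) = 0 for v ∈ X, g(v) = k for v ∈ Y. Let (A,B) be a biased barrier of G. Then for any Z ⊆ A ∩ X with N_G(Z) ∩ B = ∅, one has h(Z) ≥ 2|Z|, where h(Z) = |N_G(Z) ∩ B| + |{D : D is an odd component of G − (A ∪ B) with e_G(Z,D) ≥ 1}|. -/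
noncomputable section

theorem eCnt_eq_zero_iff {V : Type*} [Finite V] {G : SimpleGraph V} {S T : Set V} :
    eCnt G S T = 0 ↔ ∀ u ∈ S, ∀ v ∈ T, ¬ G.Adj u v := by
  rw [eCnt, Finite.card_eq_zero_iff, isEmpty_subtype]
  simp only [Prod.forall, not_and]
  exact ⟨fun h u hu v hv => h u v hu hv, fun h u v hu hv => h u hu v hv⟩

/-- A component of an induced subgraph keeps its vertex set in a larger induced subgraph
when no new vertex is adjacent to it. -/
theorem compSupp_map_induceHomOfLE {V : Type*} {G : SimpleGraph V} {s t : Set V} (hst : s ≤ t)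
    (c : (G.induce s).ConnectedComponent)
    (hc : ∀ u ∈ t \ s, ∀ v ∈ compSupp c, ¬ G.Adj u v) :
    compSupp (c.map (SimpleGraph.induceHomOfLE G hst).toHom) = compSupp c := by
  induction c using SimpleGraph.ConnectedComponent.ind with | _ u
  have closed : ∀ a b : t, (G.induce t).Adj a b →
      (a : V) ∈ compSupp ((G.induce s).connectedComponentMk u) →
      (b : V) ∈ compSupp ((G.induce s).connectedComponentMk u) := by
    rintro a b hab ha
    have hbs : (b : V) ∈ s := by
      by_contra hb
      exact hc b ⟨b.2, hb⟩ a ha (SimpleGraph.Adj.symm hab)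
    obtain ⟨a', ha', haa⟩ := ha
    refine ⟨⟨b, hbs⟩, ?_, rfl⟩
    rw [SimpleGraph.ConnectedComponent.mem_supp_iff] at ha' ⊢
    rw [← ha']
    refine SimpleGraph.ConnectedComponent.sound (SimpleGraph.Adj.reachable ?_)
    change G.Adj b a'
    rw [haa]
    exact SimpleGraph.Adj.symm hab
  have walk : ∀ a b : t, (G.induce t).Walk a b →
      (a : V) ∈ compSupp ((G.induce s).connectedComponentMk u) →
      (b : V) ∈ compSupp ((G.induce s).connectedComponentMk u) := by
    intro a b p
    induction p with
    | nil => exact id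
    | cons h _ ih => exact fun ha => ih (closed _ _ h ha)
  ext w
  constructor
  · rintro ⟨w', hw', rfl⟩
    rw [SimpleGraph.ConnectedComponent.mem_supp_iff] at hw'
    obtain ⟨p⟩ := SimpleGraph.ConnectedComponent.exact hw'.symm
    exact walk _ _ p ⟨u, rfl, rfl⟩
  · rintro ⟨w', hw', rfl⟩
    refine ⟨⟨w', hst w'.2⟩, ?_, rfl⟩
    rw [SimpleGraph.ConnectedComponent.mem_supp_iff] at hw' ⊢
    rw [← hw']
    rfl

/-- Deleting `Z` from `A` destroys at most those counted components that have a neighbour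
in `Z`. -/
theorem hWnum_le_hWnum_diff_add {V : Type*} [Finite V] (G : SimpleGraph V) (W : Set V)
    (g f : V → ℤ) (A B Z : Set V) :
    hWnum G W g f A B ≤ hWnum G W g f (A \ Z) B +
      Nat.card {c : (G.induce (A ∪ B)ᶜ).ConnectedComponent //
        IsOddComp G f A B c ∧ 1 ≤ eCnt G Z (compSupp c)} := by
  classical
  have hst : (A ∪ B)ᶜ ≤ (A \ Z ∪ B)ᶜ :=
    Set.compl_subset_compl.2 (Set.union_subset_union_left _ Set.sdiff_subset)
  have key : ∀ c : (G.induce (A ∪ B)ᶜ).ConnectedComponent, ¬ 1 ≤ eCnt G Z (compSupp c) →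
      compSupp (c.map (SimpleGraph.induceHomOfLE G hst).toHom) = compSupp c := by
    intro c hc
    have h0 := eCnt_eq_zero_iff.1 (by omega : eCnt G Z (compSupp c) = 0)
    refine compSupp_map_induceHomOfLE hst c fun u hu => h0 u ?_
    by_contra huZ
    simp only [Set.mem_sdiff, Set.mem_compl_iff, Set.mem_union] at hu
    tauto
  have : Function.Injective (fun c : {c : (G.induce (A ∪ B)ᶜ).ConnectedComponent //
      (∀ v ∈ compSupp c \ W, g v = f v) ∧ IsOddComp G f A B c} =>
      if h : 1 ≤ eCnt G Z (compSupp c.1) then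
        (Sum.inr ⟨c.1, c.2.2, h⟩ :
          {c : (G.induce (A \ Z ∪ B)ᶜ).ConnectedComponent //
            (∀ v ∈ compSupp c \ W, g v = f v) ∧ IsOddComp G f (A \ Z) B c} ⊕
          {c : (G.induce (A ∪ B)ᶜ).ConnectedComponent //
            IsOddComp G f A B c ∧ 1 ≤ eCnt G Z (compSupp c)})
      else Sum.inl ⟨c.1.map (SimpleGraph.induceHomOfLE G hst).toHom, by
        rw [IsOddComp, key _ h]; exact c.2⟩) := by
    rintro ⟨c, hc⟩ ⟨d, hd⟩ h
    dsimp only at h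
    split_ifs at h with h1 h2 h2
    · simpa using h
    · have h' := congrArg compSupp (Subtype.ext_iff.1 (Sum.inl.inj h))
      rw [key c h1, key d h2] at h'
      exact Subtype.ext (compSupp_injective h')
  unfold hWnum
  rw [← Nat.card_sum]
  exact Nat.card_le_card_of_injective _ this

/-- Effect on `δ` of deleting from `A` a set `Z` without neighbours in `B`. -/
theorem deltaG_diff_le {V : Type*} [Finite V] (G : SimpleGraph V) (W : Set V) (g f : V → ℤ)
    {A B Z : Set V} (hZA : Z ⊆ A) (hZB : ∀ z ∈ Z, ∀ b ∈ B, ¬ G.Adj z b) :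
    deltaG G W g f (A \ Z) B + ∑ᶠ v ∈ Z, f v ≤ deltaG G W g f A B +
      (Nat.card {c : (G.induce (A ∪ B)ᶜ).ConnectedComponent //
        IsOddComp G f A B c ∧ 1 ≤ eCnt G Z (compSupp c)} : ℤ) := by
  have hsum : ∑ᶠ v ∈ A, f v = (∑ᶠ v ∈ Z, f v) + ∑ᶠ v ∈ A \ Z, f v :=
    (finsum_mem_add_sdiff hZA A.toFinite).symm
  have hdeg : ∑ᶠ v ∈ B, (degDel G (A \ Z) v : ℤ) = ∑ᶠ v ∈ B, (degDel G A v : ℤ) := by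
    refine finsum_mem_congr rfl fun v hv => ?_
    have : G.neighborSet v \ (A \ Z) = G.neighborSet v \ A := by
      ext w
      simp only [Set.mem_sdiff, SimpleGraph.mem_neighborSet]
      have := fun hw : w ∈ Z => mt (SimpleGraph.Adj.symm (G := G)) (hZB w hw v hv)
      tauto
    rw [degDel, degDel, this]
  have hcomp := hWnum_le_hWnum_diff_add G W g f A B Z
  unfold deltaG
  rw [hsum, hdeg]
  omega

/-- for a biased barrier `(A,B)` and `Z ⊆ A ∩ X` with `N_G(Z) ∩ B = ∅`,
one has `h(Z) ≥ 2|Z|`, where `h(Z) = |N_G(Z) ∩ B| + #{odd components D with e_G(Z,D) ≥ 1}`. -/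
theorem biased_barrier_hZ_ge {X Y : Type*} [Fintype X] [Fintype Y]
    (G : SimpleGraph (X ⊕ Y))
    (hX : ∀ x x' : X, ¬ G.Adj (Sum.inl x) (Sum.inl x'))
    (hY : ∀ y y' : Y, ¬ G.Adj (Sum.inr y) (Sum.inr y'))
    (k : ℕ) (hk : 1 ≤ k) (heven : Even (k * Fintype.card Y))
    (hno : ¬ ∃ F : SimpleGraph (X ⊕ Y),
      IsPPFactor G F (Set.range (Sum.inl : X → X ⊕ Y)) (gB X Y k) (fB X Y k))
    (A B : Set (X ⊕ Y))
    (hAB : IsBiasedBarrier G (Set.range (Sum.inl : X → X ⊕ Y)) (gB X Y k) (fB X Y k) A B)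
    (Z : Set (X ⊕ Y)) (hZ : Z ⊆ A ∩ Set.range (Sum.inl : X → X ⊕ Y))
    (hZB : (⋃ v ∈ Z, G.neighborSet v) ∩ B = ∅) :
    2 * Z.ncard ≤ ((⋃ v ∈ Z, G.neighborSet v) ∩ B).ncard +
      Nat.card {c : (G.induce (A ∪ B)ᶜ).ConnectedComponent //
        IsOddComp G (fB X Y k) A B c ∧ 1 ≤ eCnt G Z (compSupp c)} := by
  have hadj : ∀ z ∈ Z, ∀ b ∈ B, ¬ G.Adj z b := fun z hz b hb h =>
    (Set.eq_empty_iff_forall_notMem.1 hZB b) ⟨Set.mem_biUnion hz h, hb⟩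
  have hle := deltaG_diff_le G (Set.range (Sum.inl : X → X ⊕ Y)) (gB X Y k) (fB X Y k)
    (fun z hz => (hZ hz).1) hadj
  have hsum : ∑ᶠ v ∈ Z, fB X Y k v = 2 * (Z.ncard : ℤ) := by
    have : ∑ᶠ v ∈ Z, fB X Y k v = ∑ᶠ v ∈ Z, (2 : ℤ) := by
      refine finsum_mem_congr rfl fun v hv => ?_
      obtain ⟨x, rfl⟩ := (hZ hv).2
      rfl
    rw [this, finsum_mem_eq_finite_toFinset_sum _ Z.toFinite, Finset.sum_const,
      ← Set.ncard_eq_toFinset_card Z Z.toFinite, nsmul_eq_mul, mul_comm]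
  obtain ⟨⟨hdisj, hneg⟩, hmin, -⟩ := hAB
  by_contra hlt
  have hmin' := hmin (A \ Z) B
    ⟨hdisj.mono_left Set.sdiff_subset, by omega⟩
  omega
end
end

section
/- Let G[X,Y] be a finite bipartite graph with parts X and Y having no isolated vertices from X, and let k ≥ 1 be an integer. If τ_Y(G) ≥ k and G has a Y-cutset, then |Y| ≥ 2k + 2. -/
noncomputable section

/-- The number of connected components of the strong deletion `G ⊖ S`, the induced subgraph
of `G` on the complement of `S ∪ N_G(S)`. -/
def cStrong {V : Type*} (G : SimpleGraph V) (S : Set V) : ℕ :=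
  Nat.card (G.induce ((S ∪ ⋃ v ∈ S, G.neighborSet v)ᶜ)).ConnectedComponent

/-- If no vertex of `X` is isolated, then every component of `G ⊖ S` contains a vertex of
`Y \ S`, so there are at most `|Y \ S|` components. -/
theorem ncard_add_cStrong_le {X Y : Type*} [Fintype Y] (G : SimpleGraph (X ⊕ Y))
    (hX : ∀ x x' : X, ¬ G.Adj (Sum.inl x) (Sum.inl x'))
    (hY : ∀ y y' : Y, ¬ G.Adj (Sum.inr y) (Sum.inr y'))
    (hiso : ∀ x : X, ∃ w, G.Adj (Sum.inl x) w)
    {S : Set (X ⊕ Y)} (hS : S ⊆ Set.range Sum.inr) :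
    S.ncard + cStrong G S ≤ Fintype.card Y := by
  have survives : ∀ y : Y, Sum.inr y ∉ S →
      (Sum.inr y : X ⊕ Y) ∈ (S ∪ ⋃ v ∈ S, G.neighborSet v)ᶜ := by
    intro y hy h
    rcases h with h | h
    · exact hy h
    · obtain ⟨v, hv, hvy⟩ := Set.mem_iUnion₂.1 h
      obtain ⟨y', rfl⟩ := hS hv
      exact hY y' y hvy
  set T : Set Y := Sum.inr ⁻¹' S with hT
  let f : (Tᶜ : Set Y) → (G.induce ((S ∪ ⋃ v ∈ S, G.neighborSet v)ᶜ)).ConnectedComponent :=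
    fun y => SimpleGraph.connectedComponentMk _ ⟨Sum.inr y.1, survives y.1 y.2⟩
  have hf : Function.Surjective f := by
    intro c
    induction c using SimpleGraph.ConnectedComponent.ind with | h v => ?_
    obtain ⟨x | y, hv⟩ := v
    · obtain ⟨x' | y, hxy⟩ := hiso x
      · exact absurd hxy (hX x x')
      · have hy : Sum.inr y ∉ S := fun hyS =>
          hv (Or.inr (Set.mem_iUnion₂.2 ⟨_, hyS, hxy.symm⟩))
        refine ⟨⟨y, hy⟩, SimpleGraph.ConnectedComponent.sound (SimpleGraph.Adj.reachable ?_)⟩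
        exact hxy.symm
    · exact ⟨⟨y, fun hyS => hv (Or.inl hyS)⟩, rfl⟩
  have hc : cStrong G S ≤ Tᶜ.ncard := Nat.card_le_card_of_surjective f hf
  have hST : S.ncard = T.ncard := by
    rw [← Set.ncard_image_of_injective T (Sum.inr_injective (α := X)), hT,
      Set.image_preimage_eq_of_subset hS]
  have hsum := Set.ncard_add_ncard_compl T
  rw [Nat.card_eq_fintype_card] at hsum
  lia

/-- if `G[X,Y]` has no isolated vertices in `X`, `τ_Y(G) ≥ k` and `G` has a
`Y`-cutset, then `|Y| ≥ 2k + 2`. -/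
theorem Y_large_of_cutset {X Y : Type*} [Fintype X] [Fintype Y] (G : SimpleGraph (X ⊕ Y))
    (hX : ∀ x x' : X, ¬ G.Adj (Sum.inl x) (Sum.inl x'))
    (hY : ∀ y y' : Y, ¬ G.Adj (Sum.inr y) (Sum.inr y'))
    (hiso : ∀ x : X, ∃ w, G.Adj (Sum.inl x) w)
    (k : ℕ) (hk : 1 ≤ k)
    (htough : ∀ S : Set (X ⊕ Y), S ⊆ Set.range Sum.inr →
      2 ≤ cStrong G S → k * cStrong G S ≤ S.ncard)
    (hcut : ∃ S : Set (X ⊕ Y), S ⊆ Set.range Sum.inr ∧ 2 ≤ cStrong G S) :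
    2 * k + 2 ≤ Fintype.card Y := by
  obtain ⟨S, hS, hc⟩ := hcut
  have hcard := ncard_add_cStrong_le G hX hY hiso hS
  have hmul : k * 2 ≤ k * cStrong G S := Nat.mul_le_mul_left k hc
  have hS_large := htough S hS hc
  lia
end
end
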